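/- Let f ∈ 𝓗 have Nevanlinna representation f(z) = αz + β + ∫_ℝ (1+zt)/(t−z) dρ(t), and let J ⊆ ℝ be an open interval such that the restriction of ρ to J is nonzero and singular with respect to Lebesgue measure. Then the boundary values of f are neither essentially bounded above nor essentially bounded below on J: for every M > 0, both sets {x ∈ J : f(x) > M} and {x ∈ J : f(x) < −M} have positive Lebesgue measure, where f(x) = lim_{ε↓0} f(x+iε) denotes the almost-everywhere defined boundary value. -/

import Mathlib

open Complex MeasureTheory Set Filter Topology

/-- The class `𝓗` of analytic self-maps of the upper half-plane (allowing real constants):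
`f` analytic on `ℂ⁺` with `Im f ≥ 0`. -/
def InH (f : ℂ → ℂ) : Prop :=
  DifferentiableOn ℂ f {z : ℂ | 0 < z.im} ∧ ∀ z : ℂ, 0 < z.im → 0 ≤ (f z).im

/-- The function given by the Nevanlinna formula with data `(α, β, ρ)`. -/
noncomputable def nevFun (α β : ℝ) (ρ : Measure ℝ) (z : ℂ) : ℂ :=
  (α : ℂ) * z + (β : ℂ) + ∫ t, (1 + z * (t : ℂ)) / ((t : ℂ) - z) ∂ρ

/-- `(α, β, ρ)` is a Nevanlinna representation of `f` on `ℂ⁺`. -/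
def NevRep (f : ℂ → ℂ) (α β : ℝ) (ρ : Measure ℝ) : Prop :=
  0 ≤ α ∧ IsFiniteMeasure ρ ∧ ∀ z : ℂ, 0 < z.im → f z = nevFun α β ρ z

/-- The closed support of a measure on `ℝ`. -/
def msupport (ρ : Measure ℝ) : Set ℝ := {x : ℝ | ∀ U ∈ nhds x, ρ U ≠ 0}

/-- `Ω(f) = ℝ ∖ σ(f)` for a function with Nevanlinna measure `ρ`. -/
def NevOmega (ρ : Measure ℝ) : Set ℝ := (msupport ρ)ᶜ

/-- `Γ(f) = {x ∈ Ω(f) : f(x) < 0}`, where on `Ω(f)` the (real) values of `f` are given by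
the analytic continuation, i.e. by the Nevanlinna formula. -/
def NevGamma (α β : ℝ) (ρ : Measure ℝ) : Set ℝ :=
  {x : ℝ | x ∈ NevOmega ρ ∧ (nevFun α β ρ (x : ℂ)).re < 0}

/-- An open set `O ⊆ ℝ` is Lebesgue regular if there is no point `x ∉ O` and `ε > 0` such
that `(x−ε, x+ε) ∖ O` has Lebesgue measure zero. -/
def LebesgueRegular (O : Set ℝ) : Prop :=
  ∀ x : ℝ, ∀ ε > (0 : ℝ), volume (Set.Ioo (x - ε) (x + ε) \ O) = 0 → x ∈ O

/-- The (unnormalised) Poisson kernel of the upper half-plane. -/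
noncomputable def poissonKer (y x t : ℝ) : ℝ := y / ((t - x) ^ 2 + y ^ 2)

lemma poissonKer_nonneg {y : ℝ} (hy : 0 < y) (x t : ℝ) : 0 ≤ poissonKer y x t := by
  unfold poissonKer; positivity

lemma continuous_poissonKer {y : ℝ} (hy : 0 < y) (x : ℝ) : Continuous (poissonKer y x) := by
  unfold poissonKer
  refine Continuous.div (by fun_prop) (by fun_prop) fun t => ?_
  positivity

lemma poissonKer_eq_cauchyPDFReal {y : ℝ} (hy : 0 < y) (x : ℝ) :
    poissonKer y x = fun t => Real.pi * ProbabilityTheory.cauchyPDFReal x y.toNNReal t := by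
  ext t
  have : Real.pi ≠ 0 := Real.pi_ne_zero
  rw [ProbabilityTheory.cauchyPDFReal_def, poissonKer, Real.coe_toNNReal y hy.le, div_eq_mul_inv]
  field_simp

lemma integrable_poissonKer {y : ℝ} (hy : 0 < y) (x : ℝ) : Integrable (poissonKer y x) := by
  rw [poissonKer_eq_cauchyPDFReal hy]
  exact (ProbabilityTheory.integrable_cauchyPDFReal x).const_mul _

lemma integral_poissonKer {y : ℝ} (hy : 0 < y) (x : ℝ) : ∫ t, poissonKer y x t = Real.pi := by
  rw [poissonKer_eq_cauchyPDFReal hy, integral_const_mul,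
    ProbabilityTheory.integral_cauchyPDFReal_eq_one, mul_one]
  simpa using hy

lemma lintegral_poissonKer {y : ℝ} (hy : 0 < y) (x : ℝ) :
    ∫⁻ t, ENNReal.ofReal (poissonKer y x t) = ENNReal.ofReal Real.pi := by
  rw [← integral_poissonKer hy x, ofReal_integral_eq_lintegral_ofReal (integrable_poissonKer hy x)
    (ae_of_all _ (poissonKer_nonneg hy x))]

/-- Superlevel sets of the Poisson kernel are balls. -/
lemma setOf_lt_poissonKer {y τ : ℝ} (hy : 0 < y) (x : ℝ) (hτ : 0 < τ) :
    {t | τ < poissonKer y x t} = ∅ ∨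
      ∃ s > 0, {t | τ < poissonKer y x t} = Metric.ball x s := by
  have key : ∀ t, τ < poissonKer y x t ↔ (t - x) ^ 2 < y / τ - y ^ 2 := by
    intro t
    rw [poissonKer, lt_div_iff₀ (by positivity), lt_sub_iff_add_lt, lt_div_iff₀ hτ, mul_comm]
  rcases le_or_gt (y / τ - y ^ 2) 0 with h | h
  · left
    ext t
    simp only [mem_ofPred_eq, key, mem_empty_iff_false, iff_false, not_lt]
    exact h.trans (sq_nonneg _)
  · right
    refine ⟨√(y / τ - y ^ 2), Real.sqrt_pos.2 h, ?_⟩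
    ext t
    rw [mem_ofPred_eq, key, Metric.mem_ball, Real.dist_eq, ← Real.sqrt_lt_sqrt_iff (sq_nonneg _),
      Real.sqrt_sq_eq_abs]

lemma lintegral_poissonKer_le {μ : Measure ℝ} {x y c : ℝ} (hy : 0 < y) (hc : 0 ≤ c)
    (h : ∀ s > 0, μ (Metric.ball x s) ≤ ENNReal.ofReal (c * (2 * s))) :
    ∫⁻ t, ENNReal.ofReal (poissonKer y x t) ∂μ ≤ ENNReal.ofReal (c * Real.pi) := by
  have hm : Measurable (poissonKer y x) := (continuous_poissonKer hy x).measurable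
  rw [ENNReal.ofReal_mul hc, ← lintegral_poissonKer hy x,
    lintegral_eq_lintegral_meas_lt μ (ae_of_all _ (poissonKer_nonneg hy x)) hm.aemeasurable,
    lintegral_eq_lintegral_meas_lt volume (ae_of_all _ (poissonKer_nonneg hy x)) hm.aemeasurable,
    ← lintegral_const_mul' _ _ ENNReal.ofReal_ne_top]
  refine setLIntegral_mono' measurableSet_Ioi fun τ hτ => ?_
  rcases setOf_lt_poissonKer hy x hτ with h0 | ⟨s, hs, h0⟩
  · simp [h0]
  · rw [h0, Real.volume_ball, ← ENNReal.ofReal_mul hc]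
    exact h s hs

/-- A weak-type maximal inequality for Poisson integrals of measures of small mass. -/
lemma volume_le_of_poisson_large {μ : Measure ℝ} {κ : ℝ} (hκ : 0 < κ)
    (hμ : μ univ ≤ ENNReal.ofReal (κ / 2)) {A : Set ℝ}
    (hA : ∀ x ∈ A, ∃ y, 0 < y ∧ y ≤ 1 ∧
      ENNReal.ofReal κ ≤ ∫⁻ t, ENNReal.ofReal (poissonKer y x t) ∂μ) :
    volume A ≤ ENNReal.ofReal (100 / κ) * μ univ := by
  set c : ℝ := κ / 8 with hc
  have hc0 : 0 < c := by positivity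
  have hball : ∀ x ∈ A, ∃ s, 0 < s ∧ s ≤ 1 ∧
      ENNReal.ofReal (c * (2 * s)) < μ (Metric.ball x s) := by
    intro x hx
    obtain ⟨y, hy, hy1, hxy⟩ := hA x hx
    by_contra! hcon
    have h1 : ∫⁻ t, ENNReal.ofReal (poissonKer y x t) ∂(μ.restrict (Metric.ball x 1)) ≤
        ENNReal.ofReal (c * Real.pi) := by
      refine lintegral_poissonKer_le hy hc0.le fun s hs => ?_
      rcases le_total s 1 with h | h
      · exact (Measure.restrict_apply_le _ _).trans (hcon s hs h)
      · calc (μ.restrict (Metric.ball x 1)) (Metric.ball x s)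
            ≤ μ (Metric.ball x 1) := by
              refine (measure_mono (subset_univ _)).trans ?_
              rw [Measure.restrict_apply_univ]
          _ ≤ ENNReal.ofReal (c * (2 * 1)) := hcon 1 one_pos le_rfl
          _ ≤ _ := ENNReal.ofReal_le_ofReal (by nlinarith)
    have h2 : ∫⁻ t, ENNReal.ofReal (poissonKer y x t) ∂(μ.restrict (Metric.ball x 1)ᶜ) ≤
        ENNReal.ofReal (κ / 2) := by
      calc _ ≤ ∫⁻ t, 1 ∂(μ.restrict (Metric.ball x 1)ᶜ) := by
            refine setLIntegral_mono' Metric.isOpen_ball.measurableSet.compl fun t ht => ?_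
            rw [← ENNReal.ofReal_one]
            refine ENNReal.ofReal_le_ofReal ?_
            have h3 : 1 ≤ |t - x| := by
              simpa [Real.dist_eq] using ht
            have h4 : 1 ≤ (t - x) ^ 2 := by
              rw [← sq_abs]; nlinarith
            rw [poissonKer, div_le_one (by positivity)]
            nlinarith [sq_nonneg y]
        _ ≤ μ univ := by
            rw [lintegral_one, Measure.restrict_apply_univ]
            exact measure_mono (subset_univ _)
        _ ≤ _ := hμ
    rw [← lintegral_add_compl _ Metric.isOpen_ball.measurableSet (A := Metric.ball x 1)] at hxy
    have h3 := hxy.trans (add_le_add h1 h2)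
    rw [← ENNReal.ofReal_add (by positivity) (by positivity),
      ENNReal.ofReal_le_ofReal_iff (by positivity)] at h3
    have := Real.pi_lt_d2
    rw [hc] at h3
    nlinarith
  choose! r hr0 hr1 hr using hball
  obtain ⟨u, huA, hdisj, hcov⟩ := Vitali.exists_disjoint_subfamily_covering_enlargement_ball
    A (fun x => x) r 1 hr1 5 (by norm_num)
  have hcount : u.Countable := hdisj.countable_of_isOpen (fun _ _ => Metric.isOpen_ball)
    fun a ha => Metric.nonempty_ball.2 (hr0 a (huA ha))
  have hsub : A ⊆ ⋃ b ∈ u, Metric.ball b (5 * r b) := by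
    intro a ha
    obtain ⟨b, hb, hab⟩ := hcov a ha
    exact mem_iUnion₂.2 ⟨b, hb, hab (Metric.mem_ball_self (hr0 a ha))⟩
  have : Countable u := hcount.to_subtype
  calc volume A ≤ volume (⋃ b ∈ u, Metric.ball b (5 * r b)) := measure_mono hsub
    _ ≤ ∑' b : u, volume (Metric.ball (b : ℝ) (5 * r b)) := measure_biUnion_le _ hcount _
    _ ≤ ∑' b : u, ENNReal.ofReal (100 / κ) * μ (Metric.ball (b : ℝ) (r b)) := by
        refine ENNReal.tsum_le_tsum fun b => ?_
        rw [Real.volume_ball]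
        have hb := hr b (huA b.2)
        have hb0 := hr0 b (huA b.2)
        calc ENNReal.ofReal (2 * (5 * r b))
            ≤ ENNReal.ofReal (100 / κ * (c * (2 * r b))) := by
              refine ENNReal.ofReal_le_ofReal ?_
              rw [hc]
              field_simp
              nlinarith
          _ = ENNReal.ofReal (100 / κ) * ENNReal.ofReal (c * (2 * r b)) :=
              ENNReal.ofReal_mul (by positivity)
          _ ≤ _ := by gcongr
    _ = ENNReal.ofReal (100 / κ) * μ (⋃ b ∈ u, Metric.ball b (r b)) := by
        rw [ENNReal.tsum_mul_left, measure_biUnion hcount hdisj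
          fun _ _ => Metric.isOpen_ball.measurableSet]
    _ ≤ _ := by gcongr; exact subset_univ _

/-- Cauchy's theorem on the closed upper half-plane, for functions of quadratic decay. -/
lemma integral_real_line_eq_zero {Φ : ℂ → ℂ} {ε C R₀ : ℝ} (hε : 0 < ε)
    (hΦ : DifferentiableOn ℂ Φ {z | -ε < z.im})
    (hdec : ∀ z : ℂ, 0 ≤ z.im → R₀ ≤ ‖z‖ → ‖Φ z‖ ≤ C / ‖z‖ ^ 2)
    (hIH : Integrable fun t : ℝ => Φ t) : ∫ t : ℝ, Φ t = 0 := by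
  have hlim := intervalIntegral_tendsto_integral hIH tendsto_neg_atTop_atBot tendsto_id
  have hbound : ∀ᶠ R : ℝ in atTop, ‖∫ t in (-R)..R, Φ t‖ ≤ 4 * |C| * R⁻¹ := by
    filter_upwards [eventually_ge_atTop (max R₀ 1)] with R hR
    have hR0 : R₀ ≤ R := (le_max_left _ _).trans hR
    have hR1 : 1 ≤ R := (le_max_right _ _).trans hR
    have hRpos : 0 < R := by linarith
    have hb : ∀ z : ℂ, 0 ≤ z.im → R ≤ ‖z‖ → ‖Φ z‖ ≤ |C| / R ^ 2 := by
      intro z hz hzR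
      refine (hdec z hz (hR0.trans hzR)).trans ?_
      calc C / ‖z‖ ^ 2 ≤ |C| / ‖z‖ ^ 2 := by gcongr; exact le_abs_self C
        _ ≤ _ := by gcongr
    have hrect := Complex.integral_boundary_rect_eq_zero_of_differentiableOn Φ
      ((-R : ℝ) : ℂ) (R + R * I) (hΦ.mono (by
        intro z hz
        rw [mem_reProdIm] at hz
        have := hz.2
        simp only [ofReal_im, add_im, mul_im, ofReal_re, I_re, I_im, mul_zero, mul_one, zero_add,
          uIcc_of_le hRpos.le, mem_Icc, add_zero] at this
        simp only [mem_ofPred_eq]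
        linarith [this.1]))
    simp only [ofReal_re, ofReal_im, add_re, add_im, mul_re, mul_im, I_re, I_im, mul_zero, mul_one,
      zero_add, sub_zero, add_zero, ofReal_zero, zero_mul] at hrect
    have htop : ‖∫ t : ℝ in (-R)..R, Φ (t + R * I)‖ ≤ |C| / R ^ 2 * |R - -R| := by
      refine intervalIntegral.norm_integral_le_of_norm_le_const fun t _ => hb _ (by simp [hRpos.le]) ?_
      refine le_trans ?_ (abs_im_le_norm _)
      simp [le_abs_self]
    have hright : ‖∫ t : ℝ in (0 : ℝ)..R, Φ (R + t * I)‖ ≤ |C| / R ^ 2 * |R - 0| := by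
      refine intervalIntegral.norm_integral_le_of_norm_le_const fun t ht => hb _ ?_ ?_
      · rw [uIoc_of_le hRpos.le] at ht
        simpa using ht.1.le
      · refine le_trans ?_ (abs_re_le_norm _)
        simp [le_abs_self]
    have hleft : ‖∫ t : ℝ in (0 : ℝ)..R, Φ ((-R : ℝ) + t * I)‖ ≤ |C| / R ^ 2 * |R - 0| := by
      refine intervalIntegral.norm_integral_le_of_norm_le_const fun t ht => hb _ ?_ ?_
      · rw [uIoc_of_le hRpos.le] at ht
        simpa using ht.1.le
      · refine le_trans ?_ (abs_re_le_norm _)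
        simp [le_abs_self]
    have heq : (∫ t : ℝ in (-R)..R, Φ t) = (∫ t : ℝ in (-R)..R, Φ (t + R * I)) -
        I • (∫ t : ℝ in (0 : ℝ)..R, Φ (R + t * I)) +
        I • (∫ t : ℝ in (0 : ℝ)..R, Φ ((-R : ℝ) + t * I)) := by
      linear_combination hrect
    rw [heq]
    refine (norm_add_le _ _).trans ((add_le_add (norm_sub_le _ _) le_rfl).trans ?_)
    rw [norm_smul, norm_smul, norm_I, one_mul, one_mul]
    rw [sub_neg_eq_add, abs_of_pos (by linarith : (0 : ℝ) < R + R)] at htop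
    rw [sub_zero, abs_of_pos hRpos] at hright hleft
    have : 4 * |C| * R⁻¹ = |C| / R ^ 2 * (R + R) + |C| / R ^ 2 * R + |C| / R ^ 2 * R := by
      field_simp; ring
    rw [this]
    gcongr
  have hz : Tendsto (fun R : ℝ => ∫ t in (-R)..R, Φ t) atTop (𝓝 0) := by
    refine squeeze_zero_norm' hbound ?_
    simpa using tendsto_inv_atTop_zero.const_mul (4 * |C|)
  exact tendsto_nhds_unique hlim hz

lemma norm_half_le_norm_sub {s z : ℂ} (h : 2 * ‖z‖ ≤ ‖s‖) : ‖s‖ / 2 ≤ ‖s - z‖ := by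
  have := norm_sub_norm_le s z
  linarith

lemma real_sub_mul_conj (x y t : ℝ) :
    ((t : ℂ) - (x + y * I)) * ((t : ℂ) - (x - y * I)) = (((t - x) ^ 2 + y ^ 2 : ℝ) : ℂ) := by
  push_cast
  linear_combination (-(y : ℂ) ^ 2) * I_sq

lemma real_sub_ne_zero {x y : ℝ} (hy : y ≠ 0) (t : ℝ) : (t : ℂ) - (x + y * I) ≠ 0 := by
  intro h
  have := congrArg Complex.im h
  simp at this
  exact hy this

lemma continuous_restrict_real {H : ℂ → ℂ} {ε : ℝ} (hε : 0 < ε)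
    (hH : DifferentiableOn ℂ H {z | -ε < z.im}) : Continuous fun t : ℝ => H t := by
  refine hH.continuousOn.comp_continuous continuous_ofReal fun t => ?_
  simp [hε]

lemma integrable_poissonKer_mul {H : ℂ → ℂ} {ε B x y : ℝ} (hε : 0 < ε)
    (hH : DifferentiableOn ℂ H {z | -ε < z.im}) (hB : ∀ z : ℂ, 0 ≤ z.im → ‖H z‖ ≤ B)
    (hy : 0 < y) : Integrable fun t : ℝ => (poissonKer y x t : ℂ) * H t := by
  refine (integrable_poissonKer hy x).ofReal.mul_bdd (c := B)
    (continuous_restrict_real hε hH).aestronglyMeasurable (ae_of_all _ fun t => hB _ (by simp))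

/-- The Poisson formula for bounded analytic functions. -/
lemma integral_poissonKer_mul {H : ℂ → ℂ} {ε B x y : ℝ} (hε : 0 < ε)
    (hH : DifferentiableOn ℂ H {z | -ε < z.im}) (hB : ∀ z : ℂ, 0 ≤ z.im → ‖H z‖ ≤ B)
    (hy : 0 < y) :
    ∫ t : ℝ, (poissonKer y x t : ℂ) * H t = Real.pi * H (x + y * I) := by
  set z : ℂ := x + y * I with hz
  set zc : ℂ := x - y * I with hzc
  have hzim : z.im = y := by simp [hz]
  have hzcim : zc.im = -y := by simp [hzc]
  have hnorm : ‖zc‖ = ‖z‖ := by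
    rw [← norm_conj z]; congr 1; simp [hz, hzc, sub_eq_add_neg]
  let Φ : ℂ → ℂ := fun s => dslope H z s * (y / (s - zc))
  have hΦt : ∀ t : ℝ, Φ t = (poissonKer y x t : ℂ) * H t - (poissonKer y x t : ℂ) * H z := by
    intro t
    have h1 : (t : ℂ) - z ≠ 0 := real_sub_ne_zero hy.ne' t
    have h2 : (t : ℂ) - zc ≠ 0 := by
      have := real_sub_ne_zero (x := x) (neg_ne_zero.2 hy.ne') t
      simpa [hzc, sub_eq_add_neg] using this
    simp only [Φ]
    rw [dslope_of_ne _ (sub_ne_zero.1 h1), slope_def_field, poissonKer, ofReal_div,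
      ← real_sub_mul_conj]
    change _ = y / ((t - z) * (t - zc)) * _ - y / ((t - z) * (t - zc)) * _
    field_simp
  have hIH : Integrable fun t : ℝ => (poissonKer y x t : ℂ) * H t :=
    integrable_poissonKer_mul hε hH hB hy
  have hIH₂ : Integrable fun t : ℝ => (poissonKer y x t : ℂ) * H z :=
    (integrable_poissonKer hy x).ofReal.mul_const _
  have h0 : ∫ t : ℝ, Φ t = 0 := by
    refine integral_real_line_eq_zero (ε := min ε y) (C := 8 * B * y) (R₀ := 2 * ‖z‖ + 1)
      (lt_min hε hy) ?_ ?_ ?_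
    · have hopen : IsOpen {s : ℂ | -min ε y < s.im} := isOpen_lt continuous_const continuous_im
      refine DifferentiableOn.mul ?_ ?_
      · rw [Complex.differentiableOn_dslope]
        · refine hH.mono fun s hs => ?_
          simp only [mem_ofPred_eq] at hs ⊢
          linarith [min_le_left ε y]
        · refine hopen.mem_nhds ?_
          simp only [mem_ofPred_eq, hzim]
          linarith [lt_min hε hy]
      · refine DifferentiableOn.div (by fun_prop) (by fun_prop) fun s hs h => ?_
        have := congrArg Complex.im h
        simp only [sub_im, hzcim, zero_im] at this
        simp only [mem_ofPred_eq] at hs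
        linarith [min_le_right ε y]
    · intro s hs hsR
      have hpos : 0 < ‖s‖ := by linarith [norm_nonneg z]
      have h1 : ‖s‖ / 2 ≤ ‖s - z‖ := norm_half_le_norm_sub (by linarith)
      have h2 : ‖s‖ / 2 ≤ ‖s - zc‖ := norm_half_le_norm_sub (by rw [hnorm]; linarith)
      have hne : s ≠ z := by
        rintro rfl
        simp at h1
        linarith
      simp only [Φ]
      rw [dslope_of_ne _ hne, slope_def_field, norm_mul, norm_div, norm_div, norm_real,
        Real.norm_of_nonneg hy.le]
      have h3 : ‖H s - H z‖ ≤ 2 * B := by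
        have := norm_sub_le (H s) (H z)
        linarith [hB s hs, hB z (by rw [hzim]; exact hy.le)]
      have hB0 : 0 ≤ B := (norm_nonneg _).trans (hB s hs)
      calc ‖H s - H z‖ / ‖s - z‖ * (y / ‖s - zc‖) ≤ 2 * B / (‖s‖ / 2) * (y / (‖s‖ / 2)) := by
            gcongr
        _ = _ := by field_simp; ring
    · simp only [hΦt]
      exact hIH.sub hIH₂
  simp only [hΦt] at h0
  rw [integral_sub hIH hIH₂, integral_mul_const, sub_eq_zero] at h0
  rw [h0, integral_complex_ofReal, integral_poissonKer hy]

/-- The difference of two Cauchy kernels. -/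
noncomputable def cauchyDiff (z w : ℂ) (t : ℝ) : ℂ := ((t : ℂ) - z)⁻¹ - ((t : ℂ) - w)⁻¹

lemma norm_cauchyDiff_le {x y y' : ℝ} (hy : 0 < y) (hy' : 0 < y') (t : ℝ) :
    ‖cauchyDiff (x + y * I) (x + y' * I) t‖ ≤ |y - y'| / (t - x) ^ 2 ∨ t = x := by
  by_cases htx : t = x
  · exact Or.inr htx
  left
  have h1 := real_sub_ne_zero (x := x) hy.ne' t
  have h2 := real_sub_ne_zero (x := x) hy'.ne' t
  have e1 : |t - x| ≤ ‖(t : ℂ) - (x + y * I)‖ := by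
    refine le_trans (le_of_eq ?_) (abs_re_le_norm _); simp
  have e2 : |t - x| ≤ ‖(t : ℂ) - (x + y' * I)‖ := by
    refine le_trans (le_of_eq ?_) (abs_re_le_norm _); simp
  have h3 : 0 < |t - x| := abs_pos.2 (sub_ne_zero.2 htx)
  rw [cauchyDiff, inv_sub_inv h1 h2, norm_div, norm_mul]
  have h4 : ‖(t : ℂ) - (x + y' * I) - ((t : ℂ) - (x + y * I))‖ = |y - y'| := by
    rw [show (t : ℂ) - (x + y' * I) - ((t : ℂ) - (x + y * I)) = ((y - y' : ℝ) : ℂ) * I by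
      push_cast; ring, norm_mul, norm_I, mul_one, norm_real, Real.norm_eq_abs]
  rw [h4, ← sq_abs (t - x), sq]
  gcongr

lemma continuous_cauchyDiff {x y y' : ℝ} (hy : y ≠ 0) (hy' : y' ≠ 0) :
    Continuous (cauchyDiff (x + y * I) (x + y' * I)) := by
  unfold cauchyDiff
  exact (Continuous.inv₀ (by fun_prop) (real_sub_ne_zero hy)).sub
    (Continuous.inv₀ (by fun_prop) (real_sub_ne_zero hy'))

lemma norm_real_sub_sq (x y t : ℝ) : ‖(t : ℂ) - (x + y * I)‖ ^ 2 = (t - x) ^ 2 + y ^ 2 := by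
  rw [← normSq_eq_norm_sq, normSq_apply]
  simp
  ring

lemma integrable_cauchyDiff {x y y' : ℝ} (hy : y ≠ 0) (hy' : y' ≠ 0) :
    Integrable (cauchyDiff (x + y * I) (x + y' * I)) := by
  have hi : ∀ {b : ℝ}, b ≠ 0 → Integrable fun t : ℝ => ((t - x) ^ 2 + b ^ 2)⁻¹ := by
    intro b hb
    have := (integrable_poissonKer (abs_pos.2 hb) x).const_mul (|b|⁻¹)
    refine this.congr (ae_of_all _ fun t => ?_)
    have : |b| ≠ 0 := abs_ne_zero.2 hb
    simp only [poissonKer, sq_abs]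
    field_simp
  refine Integrable.mono' (((hi hy).add (hi hy')).const_mul |y - y'|)
    (continuous_cauchyDiff hy hy').aestronglyMeasurable (ae_of_all _ fun t => ?_)
  have h1 := real_sub_ne_zero (x := x) hy t
  have h2 := real_sub_ne_zero (x := x) hy' t
  rw [cauchyDiff, inv_sub_inv h1 h2, norm_div, norm_mul]
  have h4 : ‖(t : ℂ) - (x + y' * I) - ((t : ℂ) - (x + y * I))‖ = |y - y'| := by
    rw [show (t : ℂ) - (x + y' * I) - ((t : ℂ) - (x + y * I)) = ((y - y' : ℝ) : ℂ) * I by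
      push_cast; ring, norm_mul, norm_I, mul_one, norm_real, Real.norm_eq_abs]
  rw [h4, Pi.add_apply, ← norm_real_sub_sq, ← norm_real_sub_sq, div_eq_mul_inv]
  gcongr
  have a := norm_pos_iff.2 h1
  have b := norm_pos_iff.2 h2
  rw [mul_inv, ← inv_pow, ← inv_pow]
  nlinarith [sq_nonneg (‖(t : ℂ) - (x + y * I)‖⁻¹ - ‖(t : ℂ) - (x + y' * I)‖⁻¹),
    sq_nonneg (‖(t : ℂ) - (x + y * I)‖⁻¹), sq_nonneg (‖(t : ℂ) - (x + y' * I)‖⁻¹)]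

lemma integral_mul_cauchyDiff_lower {H : ℂ → ℂ} {ε B x y y' : ℝ} (hε : 0 < ε)
    (hH : DifferentiableOn ℂ H {z | -ε < z.im}) (hB : ∀ z : ℂ, 0 ≤ z.im → ‖H z‖ ≤ B)
    (hy : 0 < y) (hy' : 0 < y') :
    ∫ t : ℝ, H t * cauchyDiff (x + (-y : ℝ) * I) (x + (-y' : ℝ) * I) t = 0 := by
  set z : ℂ := x + (-y : ℝ) * I with hz
  set w : ℂ := x + (-y' : ℝ) * I with hw
  have hzim : z.im = -y := by simp [hz]
  have hwim : w.im = -y' := by simp [hw]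
  refine integral_real_line_eq_zero (Φ := fun s => H s * ((s - z)⁻¹ - (s - w)⁻¹))
    (ε := min ε (min y y')) (C := 4 * B * ‖z - w‖) (R₀ := 2 * ‖z‖ + 2 * ‖w‖ + 1)
    (lt_min hε (lt_min hy hy')) ?_ ?_ ?_
  · refine DifferentiableOn.mul (hH.mono fun s hs => ?_) (DifferentiableOn.sub ?_ ?_)
    · simp only [mem_ofPred_eq] at hs ⊢
      linarith [min_le_left ε (min y y')]
    · refine DifferentiableOn.inv (by fun_prop) fun s hs h => ?_
      have := congrArg Complex.im h
      simp only [sub_im, hzim, zero_im] at this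
      simp only [mem_ofPred_eq] at hs
      linarith [min_le_right ε (min y y'), min_le_left y y']
    · refine DifferentiableOn.inv (by fun_prop) fun s hs h => ?_
      have := congrArg Complex.im h
      simp only [sub_im, hwim, zero_im] at this
      simp only [mem_ofPred_eq] at hs
      linarith [min_le_right ε (min y y'), min_le_right y y']
  · intro s hs hsR
    have hpos : 0 < ‖s‖ := by linarith [norm_nonneg z, norm_nonneg w]
    have h1 : ‖s‖ / 2 ≤ ‖s - z‖ := norm_half_le_norm_sub (by linarith [norm_nonneg w])
    have h2 : ‖s‖ / 2 ≤ ‖s - w‖ := norm_half_le_norm_sub (by linarith [norm_nonneg z])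
    have hn1 : s - z ≠ 0 := norm_pos_iff.1 (by linarith)
    have hn2 : s - w ≠ 0 := norm_pos_iff.1 (by linarith)
    have hB0 : 0 ≤ B := (norm_nonneg _).trans (hB s hs)
    rw [inv_sub_inv hn1 hn2, norm_mul, norm_div, norm_mul,
      show s - w - (s - z) = z - w by ring]
    calc ‖H s‖ * (‖z - w‖ / (‖s - z‖ * ‖s - w‖))
        ≤ B * (‖z - w‖ / ((‖s‖ / 2) * (‖s‖ / 2))) := by
          gcongr
          exact hB s hs
      _ = _ := by field_simp; ring
  · have := (integrable_cauchyDiff (x := x) (neg_ne_zero.2 hy.ne') (neg_ne_zero.2 hy'.ne')).bdd_mul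
      (c := B) (continuous_restrict_real hε hH).aestronglyMeasurable
      (ae_of_all _ fun t => hB _ (by simp))
    exact this

/-- Increments of a bounded analytic function are controlled by the imaginary part of its boundary
values. -/
lemma norm_sub_le_integral_im {H : ℂ → ℂ} {ε B x y y' : ℝ} (hε : 0 < ε)
    (hH : DifferentiableOn ℂ H {z | -ε < z.im}) (hB : ∀ z : ℂ, 0 ≤ z.im → ‖H z‖ ≤ B)
    (hy : 0 < y) (hy' : 0 < y') :
    ‖H (x + y * I) - H (x + y' * I)‖ ≤
      ∫ t : ℝ, |(H t).im| * ‖cauchyDiff (x + y * I) (x + y' * I) t‖ := by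
  set k := cauchyDiff (x + y * I) (x + y' * I) with hk
  set kc := cauchyDiff (x + (-y : ℝ) * I) (x + (-y' : ℝ) * I) with hkc
  have hconj : ∀ t, kc t = starRingEnd ℂ (k t) := by
    intro t
    simp [hk, hkc, cauchyDiff]
  have hcont := (continuous_restrict_real hε hH)
  have hBt : ∀ᵐ t : ℝ, ‖H t‖ ≤ B := ae_of_all _ fun t => hB _ (by simp)
  have ik : Integrable fun t : ℝ => H t * k t :=
    (integrable_cauchyDiff hy.ne' hy'.ne').bdd_mul hcont.aestronglyMeasurable hBt
  have ikc : Integrable fun t : ℝ => H t * kc t :=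
    (integrable_cauchyDiff (neg_ne_zero.2 hy.ne') (neg_ne_zero.2 hy'.ne')).bdd_mul
      hcont.aestronglyMeasurable hBt
  have h0 : ∫ t : ℝ, H t * kc t = 0 := integral_mul_cauchyDiff_lower hε hH hB hy hy'
  have ihc : Integrable fun t : ℝ => starRingEnd ℂ (H t) * k t := by
    have := Complex.conjCLE.toContinuousLinearMap.integrable_comp ikc
    refine this.congr (ae_of_all _ fun t => ?_)
    simp [hconj]
  have h0' : ∫ t : ℝ, starRingEnd ℂ (H t) * k t = 0 := by
    have := congrArg (starRingEnd ℂ) h0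
    rw [← integral_conj, map_zero] at this
    rw [← this]
    congr 1 with t
    simp [hconj]
  have hdiff : ∀ t : ℝ, H t * k t - H t * kc t =
      2 * I * ((poissonKer y x t : ℂ) * H t - (poissonKer y' x t : ℂ) * H t) := by
    intro t
    have e : ∀ b : ℝ, b ≠ 0 → ((t : ℂ) - (x + b * I))⁻¹ - ((t : ℂ) - (x + (-b : ℝ) * I))⁻¹ =
        2 * I * (poissonKer b x t : ℂ) := by
      intro b hb
      have h1 := real_sub_ne_zero (x := x) hb t
      have h2 := real_sub_ne_zero (x := x) (neg_ne_zero.2 hb) t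
      have h3 := real_sub_mul_conj x b t
      rw [inv_sub_inv h1 h2, poissonKer, ofReal_div, ← h3]
      push_cast
      rw [show (x : ℂ) + -(b : ℂ) * I = x - b * I by ring]
      ring
    have e1 := e y hy.ne'
    have e2 := e y' hy'.ne'
    simp only [hk, hkc, cauchyDiff]
    linear_combination H t * e1 - H t * e2
  have i1 : Integrable fun t : ℝ => (poissonKer y x t : ℂ) * H t :=
    integrable_poissonKer_mul hε hH hB hy
  have i2 : Integrable fun t : ℝ => (poissonKer y' x t : ℂ) * H t :=
    integrable_poissonKer_mul hε hH hB hy'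
  have h1 : ∫ t : ℝ, H t * k t = 2 * I * (Real.pi * (H (x + y * I) - H (x + y' * I))) := by
    have : ∫ t : ℝ, (H t * k t - H t * kc t) = ∫ t : ℝ, H t * k t := by
      rw [integral_sub ik ikc, h0, sub_zero]
    rw [← this]
    simp only [hdiff]
    rw [integral_const_mul, integral_sub i1 i2, integral_poissonKer_mul hε hH hB hy,
      integral_poissonKer_mul hε hH hB hy']
    ring
  have h2 : ∫ t : ℝ, (((H t).im : ℝ) : ℂ) * k t =
      Real.pi * (H (x + y * I) - H (x + y' * I)) := by
    have h3 : ∫ t : ℝ, (H t * k t - starRingEnd ℂ (H t) * k t) =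
        2 * I * (Real.pi * (H (x + y * I) - H (x + y' * I))) := by
      rw [integral_sub ik ihc, h0', h1, sub_zero]
    have h4 : ∀ t : ℝ, H t * k t - starRingEnd ℂ (H t) * k t =
        2 * I * ((((H t).im : ℝ) : ℂ) * k t) := by
      intro t
      rw [← sub_mul, sub_conj]
      push_cast
      ring
    simp only [h4] at h3
    rw [integral_const_mul] at h3
    exact mul_left_cancel₀ (mul_ne_zero two_ne_zero I_ne_zero) h3
  calc ‖H (x + y * I) - H (x + y' * I)‖
      ≤ Real.pi * ‖H (x + y * I) - H (x + y' * I)‖ := by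
        have := Real.pi_gt_three
        nlinarith [norm_nonneg (H (x + y * I) - H (x + y' * I))]
    _ = ‖∫ t : ℝ, (((H t).im : ℝ) : ℂ) * k t‖ := by
        rw [h2, norm_mul, norm_real, Real.norm_of_nonneg Real.pi_pos.le]
    _ ≤ ∫ t : ℝ, ‖(((H t).im : ℝ) : ℂ) * k t‖ := norm_integral_le_integral_norm _
    _ = _ := by simp only [norm_mul, norm_real, Real.norm_eq_abs]

/-- A bounded analytic function with almost everywhere real boundary values near `x` is Lipschitz
along the vertical ray over `x`. -/
lemma norm_sub_le_of_im_tendsto_zero {E : ℂ → ℂ} {x d : ℝ} (hd : 0 < d)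
    (hE : DifferentiableOn ℂ E {z | 0 < z.im}) (hB : ∀ z : ℂ, 0 < z.im → ‖E z‖ ≤ 1)
    (him : ∀ᵐ t : ℝ, t ∈ Metric.ball x d →
      Tendsto (fun ε : ℝ => (E (t + ε * I)).im) (𝓝[>] 0) (𝓝 0))
    {y y' : ℝ} (hy : 0 < y) (hy' : 0 < y') :
    ‖E (x + y * I) - E (x + y' * I)‖ ≤ |y - y'| * (1 + (d ^ 2)⁻¹) * Real.pi := by
  set k := cauchyDiff (x + y * I) (x + y' * I) with hk
  have ik : Integrable k := integrable_cauchyDiff hy.ne' hy'.ne'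
  let ε : ℕ → ℝ := fun n => 1 / ((n : ℝ) + 1)
  have hεpos : ∀ n, 0 < ε n := fun n => by positivity
  have hε0 : Tendsto ε atTop (𝓝 0) := tendsto_one_div_add_atTop_nhds_zero_nat
  have hεw : Tendsto ε atTop (𝓝[>] 0) :=
    tendsto_nhdsWithin_iff.2 ⟨hε0, Eventually.of_forall hεpos⟩
  let H : ℕ → ℂ → ℂ := fun n s => E (s + ε n * I)
  have hHd : ∀ n, DifferentiableOn ℂ (H n) {z | -(ε n) < z.im} := by
    intro n
    refine hE.comp (by fun_prop) fun s hs => ?_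
    simp only [mem_ofPred_eq, add_im, mul_im, ofReal_re, I_im, mul_one, ofReal_im, I_re, mul_zero,
      add_zero] at hs ⊢
    linarith
  have hHB : ∀ n, ∀ z : ℂ, 0 ≤ z.im → ‖H n z‖ ≤ 1 := by
    intro n z hz
    refine hB _ ?_
    simp only [add_im, mul_im, ofReal_re, I_im, mul_one, ofReal_im, I_re, mul_zero, add_zero]
    linarith [hεpos n]
  have hHc : ∀ n, Continuous fun t : ℝ => H n t := fun n =>
    continuous_restrict_real (hεpos n) (hHd n)
  have himle : ∀ n, ∀ t : ℝ, |(H n t).im| ≤ 1 := fun n t =>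
    (abs_im_le_norm _).trans (hHB n _ (by simp))
  let g : ℕ → ℝ → ℝ := fun n => (Metric.ball x d).indicator fun t => |(H n t).im| * ‖k t‖
  have hgmeas : ∀ n, AEStronglyMeasurable (g n) := fun n => by
    refine AEStronglyMeasurable.indicator ?_ measurableSet_ball
    exact ((continuous_im.comp (hHc n)).abs.aestronglyMeasurable).mul ik.norm.aestronglyMeasurable
  have hgle : ∀ n, ∀ t, ‖g n t‖ ≤ ‖k t‖ := by
    intro n t
    refine (norm_indicator_le_norm_self _ _).trans ?_
    rw [norm_mul, norm_norm, Real.norm_eq_abs, abs_abs]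
    exact mul_le_of_le_one_left (norm_nonneg _) (himle n t)
  have hgint : ∀ n, Integrable (g n) := fun n =>
    ik.norm.mono' (hgmeas n) (ae_of_all _ (hgle n))
  have hlim : Tendsto (fun n => ∫ t, g n t) atTop (𝓝 0) := by
    have := tendsto_integral_of_dominated_convergence (f := fun _ => (0 : ℝ)) (fun t => ‖k t‖)
      hgmeas ik.norm (fun n => ae_of_all _ (hgle n)) ?_
    · simpa using this
    filter_upwards [him] with t ht
    by_cases hmem : t ∈ Metric.ball x d
    · simp only [g, indicator_of_mem hmem]
      simpa using (((ht hmem).comp hεw).abs).mul_const ‖k t‖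
    · simp only [g, indicator_of_notMem hmem]
      exact tendsto_const_nhds
  have hbd : ∀ n, ‖H n (x + y * I) - H n (x + y' * I)‖ ≤
      (∫ t, g n t) + |y - y'| * (1 + (d ^ 2)⁻¹) * Real.pi := by
    intro n
    refine (norm_sub_le_integral_im (hεpos n) (hHd n) (hHB n) hy hy').trans ?_
    rw [← integral_poissonKer one_pos x, ← integral_const_mul, ← integral_add (hgint n)
      ((integrable_poissonKer one_pos x).const_mul _)]
    refine integral_mono_of_nonneg (ae_of_all _ fun t => by positivity)
      ((hgint n).add ((integrable_poissonKer one_pos x).const_mul _)) (ae_of_all _ fun t => ?_)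
    have hP := poissonKer_nonneg one_pos x t
    change |(H n t).im| * ‖k t‖ ≤ g n t + |y - y'| * (1 + (d ^ 2)⁻¹) * poissonKer 1 x t
    by_cases hmem : t ∈ Metric.ball x d
    · simp only [g, indicator_of_mem hmem]
      have : 0 ≤ |y - y'| * (1 + (d ^ 2)⁻¹) * poissonKer 1 x t := by positivity
      linarith
    · simp only [g, indicator_of_notMem hmem, zero_add]
      have hdt : d ≤ |t - x| := by
        rw [Metric.mem_ball, Real.dist_eq, not_lt] at hmem
        exact hmem
      have hdt2 : d ^ 2 ≤ (t - x) ^ 2 := by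
        rw [← sq_abs (t - x)]
        gcongr
      rcases norm_cauchyDiff_le (x := x) hy hy' t with h | h
      · refine (mul_le_of_le_one_left (norm_nonneg _) (himle n t)).trans (h.trans ?_)
        have hpos : 0 < (t - x) ^ 2 := lt_of_lt_of_le (by positivity) hdt2
        have : 1 / (t - x) ^ 2 ≤ (1 + (d ^ 2)⁻¹) * poissonKer 1 x t := by
          rw [poissonKer, one_pow, mul_one_div, div_le_div_iff₀ hpos (by positivity)]
          have : 1 ≤ (d ^ 2)⁻¹ * (t - x) ^ 2 := by
            rw [inv_mul_eq_div, le_div_iff₀ (by positivity)]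
            linarith
          linarith
        calc |y - y'| / (t - x) ^ 2 = |y - y'| * (1 / (t - x) ^ 2) := by ring
          _ ≤ |y - y'| * ((1 + (d ^ 2)⁻¹) * poissonKer 1 x t) := by gcongr
          _ = _ := by ring
      · rw [h, sub_self, abs_zero] at hdt
        linarith
  have hcont : ∀ b : ℝ, 0 < b → Tendsto (fun n => H n (x + b * I)) atTop (𝓝 (E (x + b * I))) := by
    intro b hb
    have hopen : IsOpen {z : ℂ | 0 < z.im} := isOpen_lt continuous_const continuous_im
    have h1 : ContinuousAt E (x + b * I) :=
      (hE.differentiableAt (hopen.mem_nhds (by simp [hb]))).continuousAt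
    refine h1.tendsto.comp ?_
    have : Tendsto (fun n => (x + b * I : ℂ) + ((ε n : ℝ) : ℂ) * I) atTop
        (𝓝 (x + b * I + ((0 : ℝ) : ℂ) * I)) :=
      (((continuous_ofReal.tendsto 0).comp hε0).mul_const I).const_add _
    simpa using this
  have h1 := ((hcont y hy).sub (hcont y' hy')).norm
  have h2 := hlim.add_const (|y - y'| * (1 + (d ^ 2)⁻¹) * Real.pi)
  rw [zero_add] at h2
  exact le_of_tendsto_of_tendsto' h1 h2 hbd

lemma im_le_norm_real_sub (z : ℂ) (t : ℝ) : z.im ≤ ‖(t : ℂ) - z‖ := by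
  have := abs_im_le_norm ((t : ℂ) - z)
  simp only [sub_im, ofReal_im, zero_sub, abs_neg] at this
  exact (le_abs_self _).trans this

lemma real_sub_ne_zero_of_im_pos {z : ℂ} (hz : 0 < z.im) (t : ℝ) : (t : ℂ) - z ≠ 0 :=
  norm_pos_iff.1 (hz.trans_le (im_le_norm_real_sub z t))

lemma norm_inv_real_sub_le {z : ℂ} (hz : 0 < z.im) (t : ℝ) : ‖((t : ℂ) - z)⁻¹‖ ≤ z.im⁻¹ := by
  rw [norm_inv]
  gcongr
  exact im_le_norm_real_sub z t

lemma continuous_inv_real_sub {z : ℂ} (hz : 0 < z.im) : Continuous fun t : ℝ => ((t : ℂ) - z)⁻¹ :=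
  Continuous.inv₀ (by fun_prop) (real_sub_ne_zero_of_im_pos hz)

lemma integrable_inv_real_sub (ν : Measure ℝ) [IsFiniteMeasure ν] {z : ℂ} (hz : 0 < z.im) :
    Integrable (fun t : ℝ => ((t : ℂ) - z)⁻¹) ν :=
  (integrable_const (z.im⁻¹)).mono' (continuous_inv_real_sub hz).aestronglyMeasurable
    (ae_of_all _ (norm_inv_real_sub_le hz))

lemma nevanlinna_kernel_eq {z : ℂ} {t : ℝ} (h : (t : ℂ) - z ≠ 0) :
    (1 + z * t) / ((t : ℂ) - z) = z + (1 + z ^ 2) * ((t : ℂ) - z)⁻¹ := by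
  field_simp
  ring

lemma integrable_nevanlinna_kernel (ν : Measure ℝ) [IsFiniteMeasure ν] {z : ℂ} (hz : 0 < z.im) :
    Integrable (fun t : ℝ => (1 + z * t) / ((t : ℂ) - z)) ν := by
  have := (integrable_const (μ := ν) z).add ((integrable_inv_real_sub ν hz).const_mul (1 + z ^ 2))
  refine this.congr (ae_of_all _ fun t => ?_)
  exact (nevanlinna_kernel_eq (real_sub_ne_zero_of_im_pos hz t)).symm

lemma nevFun_eq_cauchy (α β : ℝ) (ν : Measure ℝ) [IsFiniteMeasure ν] {z : ℂ} (hz : 0 < z.im) :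
    nevFun α β ν z = α * z + β + (ν.real univ * z + (1 + z ^ 2) * ∫ t, ((t : ℂ) - z)⁻¹ ∂ν) := by
  rw [nevFun, integral_congr_ae (ae_of_all _ fun t =>
    nevanlinna_kernel_eq (real_sub_ne_zero_of_im_pos hz t)), integral_add (integrable_const _)
    ((integrable_inv_real_sub ν hz).const_mul _), integral_const_mul, integral_const]
  simp

lemma nevFun_add_measure (α β : ℝ) (ν ν' : Measure ℝ) [IsFiniteMeasure ν] [IsFiniteMeasure ν']
    {z : ℂ} (hz : 0 < z.im) : nevFun α β (ν + ν') z = nevFun α β ν z + nevFun 0 0 ν' z := by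
  rw [nevFun, nevFun, nevFun, integral_add_measure (integrable_nevanlinna_kernel ν hz)
    (integrable_nevanlinna_kernel ν' hz)]
  simp
  ring

lemma differentiableOn_cauchy (ν : Measure ℝ) [IsFiniteMeasure ν] :
    DifferentiableOn ℂ (fun z : ℂ => ∫ t : ℝ, ((t : ℂ) - z)⁻¹ ∂ν) {z | 0 < z.im} := by
  intro z₀ hz₀
  simp only [mem_ofPred_eq] at hz₀
  have hopen : IsOpen {z : ℂ | z₀.im / 2 < z.im} := isOpen_lt continuous_const continuous_im
  have hmem : {z : ℂ | z₀.im / 2 < z.im} ∈ 𝓝 z₀ := hopen.mem_nhds (by simp [hz₀])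
  have hpos : ∀ z ∈ {z : ℂ | z₀.im / 2 < z.im}, 0 < z.im := fun z hz => by
    simp only [mem_ofPred_eq] at hz
    linarith
  have := hasDerivAt_integral_of_dominated_loc_of_deriv_le (μ := ν) (𝕜 := ℂ)
    (F := fun (z : ℂ) (t : ℝ) => ((t : ℂ) - z)⁻¹) (F' := fun z t => (((t : ℂ) - z) ^ 2)⁻¹)
    (x₀ := z₀) (s := {z : ℂ | z₀.im / 2 < z.im}) (bound := fun _ => ((z₀.im / 2) ^ 2)⁻¹)
    hmem
    (Filter.mem_of_superset hmem fun z hz =>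
      (continuous_inv_real_sub (hpos z hz)).aestronglyMeasurable)
    (integrable_inv_real_sub ν hz₀)
    (Continuous.aestronglyMeasurable (Continuous.inv₀ (by fun_prop) fun t =>
      pow_ne_zero 2 (real_sub_ne_zero_of_im_pos hz₀ t)))
    (ae_of_all _ fun t z hz => by
      rw [norm_inv, norm_pow]
      have h1 := im_le_norm_real_sub z t
      simp only [mem_ofPred_eq] at hz
      gcongr
      linarith)
    (integrable_const _)
    (ae_of_all _ fun t z hz => by
      have h := ((hasDerivAt_id z).const_sub (t : ℂ)).fun_inv (real_sub_ne_zero_of_im_pos (hpos z hz) t)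
      simpa using h)
  exact this.2.differentiableAt.differentiableWithinAt

lemma differentiableOn_nevFun (α β : ℝ) (ν : Measure ℝ) [IsFiniteMeasure ν] :
    DifferentiableOn ℂ (nevFun α β ν) {z | 0 < z.im} := by
  have h := differentiableOn_cauchy ν
  have : DifferentiableOn ℂ (fun z : ℂ => α * z + β + (ν.real univ * z +
      (1 + z ^ 2) * ∫ t, ((t : ℂ) - z)⁻¹ ∂ν)) {z | 0 < z.im} := by
    refine DifferentiableOn.add (by fun_prop) (DifferentiableOn.add (by fun_prop)
      (DifferentiableOn.mul (by fun_prop) h))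
  exact this.congr fun z hz => nevFun_eq_cauchy α β ν hz

lemma norm_cauchy_le (ν : Measure ℝ) [IsFiniteMeasure ν] {z : ℂ} (hz : 0 < z.im) :
    ‖∫ t : ℝ, ((t : ℂ) - z)⁻¹ ∂ν‖ ≤ z.im⁻¹ * ν.real univ :=
  norm_integral_le_of_norm_le_const (ae_of_all _ (norm_inv_real_sub_le hz))

lemma im_nevanlinna_kernel {x y : ℝ} (hy : 0 < y) (t : ℝ) :
    ((1 + (x + y * I : ℂ) * t) / ((t : ℂ) - (x + y * I))).im = (1 + t ^ 2) * poissonKer y x t := by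
  have h := real_sub_mul_conj x y t
  have h1 := real_sub_ne_zero (x := x) hy.ne' t
  have h2 : (t : ℂ) - (x - y * I) ≠ 0 := by
    have := real_sub_ne_zero (x := x) (neg_ne_zero.2 hy.ne') t
    simpa [sub_eq_add_neg] using this
  rw [← mul_div_mul_right _ _ h2, h, div_ofReal_im, poissonKer, mul_div_assoc']
  congr 1
  simp
  ring

lemma im_nevFun (α β : ℝ) (ν : Measure ℝ) [IsFiniteMeasure ν] {x y : ℝ} (hy : 0 < y) :
    (nevFun α β ν (x + y * I)).im = α * y + ∫ t, (1 + t ^ 2) * poissonKer y x t ∂ν := by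
  have hz : 0 < (x + y * I : ℂ).im := by simp [hy]
  have := integral_im (integrable_nevanlinna_kernel ν hz)
  simp only [RCLike.im_to_complex, im_nevanlinna_kernel hy] at this
  rw [nevFun, add_im, ← this]
  simp

lemma integrable_im_nevanlinna_kernel (ν : Measure ℝ) [IsFiniteMeasure ν] {x y : ℝ} (hy : 0 < y) :
    Integrable (fun t => (1 + t ^ 2) * poissonKer y x t) ν := by
  have hz : 0 < (x + y * I : ℂ).im := by simp [hy]
  have := (integrable_nevanlinna_kernel ν hz).im
  simpa only [RCLike.im_to_complex, im_nevanlinna_kernel hy] using this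

lemma im_nevFun_nonneg {α : ℝ} (hα : 0 ≤ α) (β : ℝ) (ν : Measure ℝ) [IsFiniteMeasure ν] {z : ℂ}
    (hz : 0 < z.im) : 0 ≤ (nevFun α β ν z).im := by
  rw [← re_add_im z, im_nevFun α β ν hz]
  have : 0 ≤ ∫ t, (1 + t ^ 2) * poissonKer z.im z.re t ∂ν :=
    integral_nonneg fun t => mul_nonneg (by positivity) (poissonKer_nonneg hz _ _)
  positivity

lemma le_im_nevFun {α : ℝ} (hα : 0 ≤ α) (β : ℝ) (ν : Measure ℝ) [IsFiniteMeasure ν] {x y : ℝ}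
    (hy : 0 < y) : ν.real (Metric.closedBall x y) / (2 * y) ≤ (nevFun α β ν (x + y * I)).im := by
  have hnn : ∀ t, 0 ≤ (1 + t ^ 2) * poissonKer y x t := fun t =>
    mul_nonneg (by positivity) (poissonKer_nonneg hy _ _)
  rw [im_nevFun α β ν hy]
  calc ν.real (Metric.closedBall x y) / (2 * y)
      = ∫ t in Metric.closedBall x y, 1 / (2 * y) ∂ν := by
        simp [div_eq_mul_inv]
    _ ≤ ∫ t in Metric.closedBall x y, (1 + t ^ 2) * poissonKer y x t ∂ν := by
        refine setIntegral_mono_on (integrable_const _)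
          (integrable_im_nevanlinna_kernel ν hy).integrableOn measurableSet_closedBall fun t ht => ?_
        rw [Metric.mem_closedBall, Real.dist_eq] at ht
        have h1 : (t - x) ^ 2 ≤ y ^ 2 := sq_le_sq' (by linarith [neg_abs_le (t - x)])
          (by linarith [le_abs_self (t - x)])
        have h2 : 1 / (2 * y) ≤ poissonKer y x t := by
          rw [poissonKer, div_le_div_iff₀ (by positivity) (by positivity)]
          nlinarith
        have h3 := poissonKer_nonneg hy x t
        nlinarith [sq_nonneg t, mul_nonneg (sq_nonneg t) h3]
    _ ≤ ∫ t, (1 + t ^ 2) * poissonKer y x t ∂ν :=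
        setIntegral_le_integral (integrable_im_nevanlinna_kernel ν hy) (ae_of_all _ hnn)
    _ ≤ _ := by
        have : 0 ≤ α * y := by positivity
        linarith

lemma im_nevFun_pos {α : ℝ} (hα : 0 ≤ α) (β : ℝ) {ν : Measure ℝ} [IsFiniteMeasure ν] (hν : ν ≠ 0)
    {z : ℂ} (hz : 0 < z.im) : 0 < (nevFun α β ν z).im := by
  rw [← re_add_im z, im_nevFun α β ν hz]
  have : 0 < ∫ t, (1 + t ^ 2) * poissonKer z.im z.re t ∂ν := by
    have hpos : ∀ t, 0 < (1 + t ^ 2) * poissonKer z.im z.re t := fun t => by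
      rw [poissonKer]
      positivity
    rw [integral_pos_iff_support_of_nonneg (fun t => (hpos t).le)
      (integrable_im_nevanlinna_kernel ν hz)]
    rw [show Function.support (fun t => (1 + t ^ 2) * poissonKer z.im z.re t) = univ from
      eq_univ_of_forall fun t => (hpos t).ne']
    exact Measure.measure_univ_pos.2 hν
  positivity

/-- Off the support of the measure the boundary values exist and are real. -/
lemma exists_tendsto_nevFun (α β : ℝ) (ν : Measure ℝ) [IsFiniteMeasure ν] {x d : ℝ} (hd : 0 < d)
    (hν : ν (Metric.ball x d) = 0) :
    ∃ L : ℝ, Tendsto (fun ε : ℝ => nevFun α β ν (x + ε * I)) (𝓝[>] 0) (𝓝 (L : ℂ)) := by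
  have hz : Tendsto (fun ε : ℝ => (x + ε * I : ℂ)) (𝓝[>] 0) (𝓝 x) := by
    have : Tendsto (fun ε : ℝ => (x + ε * I : ℂ)) (𝓝 0) (𝓝 (x + (0 : ℝ) * I)) :=
      Continuous.tendsto (by fun_prop) 0
    rw [ofReal_zero, zero_mul, add_zero] at this
    exact this.mono_left nhdsWithin_le_nhds
  have hae : ∀ᵐ t ∂ν, d ≤ |t - x| := by
    have : ∀ᵐ t ∂ν, t ∉ Metric.ball x d := measure_eq_zero_iff_ae_notMem.1 hν
    filter_upwards [this] with t ht
    rwa [Metric.mem_ball, Real.dist_eq, not_lt] at ht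
  have hlim : Tendsto (fun ε : ℝ => ∫ t : ℝ, ((t : ℂ) - (x + ε * I))⁻¹ ∂ν) (𝓝[>] 0)
      (𝓝 (∫ t : ℝ, ((t : ℂ) - x)⁻¹ ∂ν)) := by
    refine tendsto_integral_filter_of_dominated_convergence (fun _ => d⁻¹) ?_ ?_
      (integrable_const _) ?_
    · filter_upwards [self_mem_nhdsWithin] with ε hε
      exact (continuous_inv_real_sub (by simpa using hε)).aestronglyMeasurable
    · refine Eventually.of_forall fun ε => ?_
      filter_upwards [hae] with t ht
      rw [norm_inv]
      gcongr
      refine ht.trans (le_trans (le_of_eq ?_) (abs_re_le_norm _))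
      simp
    · filter_upwards [hae] with t ht
      have hne : (t : ℂ) - x ≠ 0 := by
        rw [← ofReal_sub, ofReal_ne_zero, ← abs_pos]
        linarith
      exact (hz.const_sub (t : ℂ)).inv₀ hne
  have hreal : ∫ t : ℝ, ((t : ℂ) - x)⁻¹ ∂ν = ((∫ t : ℝ, (t - x)⁻¹ ∂ν : ℝ) : ℂ) := by
    rw [← integral_complex_ofReal]
    push_cast
    rfl
  rw [hreal] at hlim
  refine ⟨α * x + β + (ν.real univ * x + (1 + x ^ 2) * ∫ t : ℝ, (t - x)⁻¹ ∂ν), ?_⟩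
  have h := ((hz.const_mul (α : ℂ)).add_const (β : ℂ)).add ((hz.const_mul (ν.real univ : ℂ)).add
    (((hz.pow 2).const_add 1).mul hlim))
  refine Tendsto.congr' ?_ (by simpa only [ofReal_add, ofReal_mul, ofReal_pow, ofReal_one] using h)
  filter_upwards [self_mem_nhdsWithin] with ε hε
  exact (nevFun_eq_cauchy α β ν (by simpa using hε)).symm

/-- The growth of `nevFun` along a vertical ray is at most of order `1 / y`. -/
lemma exists_norm_nevFun_le (α β : ℝ) (ν : Measure ℝ) [IsFiniteMeasure ν] (x : ℝ) :
    ∃ C : ℝ, ∀ y : ℝ, 0 < y → y ≤ 1 → ‖nevFun α β ν (x + y * I)‖ ≤ C / y := by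
  set m := ν.real univ
  have hm : 0 ≤ m := measureReal_nonneg
  refine ⟨|α| * (|x| + 1) + |β| + (m * (|x| + 1) + (1 + (|x| + 1) ^ 2) * m), fun y hy hy1 => ?_⟩
  have hz : 0 < (x + y * I : ℂ).im := by simp [hy]
  have hzn : ‖(x + y * I : ℂ)‖ ≤ |x| + 1 := by
    refine (norm_add_le _ _).trans ?_
    rw [norm_mul, norm_I, norm_real, norm_real, Real.norm_of_nonneg hy.le, Real.norm_eq_abs]
    linarith
  have hc := norm_cauchy_le ν hz
  have him : (x + y * I : ℂ).im = y := by simp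
  rw [him] at hc
  have hy1' : 1 ≤ y⁻¹ := (one_le_inv₀ hy).2 hy1
  have h2 : ‖(1 + (x + y * I : ℂ) ^ 2)‖ ≤ 1 + (|x| + 1) ^ 2 := by
    refine (norm_add_le _ _).trans ?_
    rw [norm_one, norm_pow]
    gcongr
  rw [nevFun_eq_cauchy α β ν hz]
  calc _ ≤ ‖(α : ℂ)‖ * ‖(x + y * I : ℂ)‖ + ‖(β : ℂ)‖ + (‖(m : ℂ)‖ * ‖(x + y * I : ℂ)‖ +
        ‖(1 + (x + y * I : ℂ) ^ 2)‖ * ‖∫ t : ℝ, ((t : ℂ) - (x + y * I))⁻¹ ∂ν‖) := by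
        simp only [← norm_mul]
        refine (norm_add_le _ _).trans (add_le_add (norm_add_le _ _) (norm_add_le _ _))
    _ ≤ |α| * (|x| + 1) + |β| + (m * (|x| + 1) + (1 + (|x| + 1) ^ 2) * (y⁻¹ * m)) := by
        simp only [norm_real, Real.norm_eq_abs, abs_of_nonneg hm]
        gcongr
    _ ≤ (|α| * (|x| + 1) + |β| + m * (|x| + 1)) * y⁻¹ + (1 + (|x| + 1) ^ 2) * m * y⁻¹ := by
        have : 0 ≤ |α| * (|x| + 1) + |β| + m * (|x| + 1) := by positivity
        nlinarith
    _ = _ := by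
        rw [div_eq_mul_inv]
        ring

lemma norm_nevFun_imaginary_le (ν : Measure ℝ) [IsFiniteMeasure ν] {s : ℝ} (h1 : 1 ≤ s)
    (h2 : s ≤ 2) : ‖nevFun 0 0 ν (s * I)‖ ≤ 5 * ν.real univ := by
  have hs : 0 < s := by linarith
  have hz : 0 < (s * I : ℂ).im := by simp [hs]
  have hm : 0 ≤ ν.real univ := measureReal_nonneg
  have hc := norm_cauchy_le ν hz
  have him : (s * I : ℂ).im = s := by simp
  rw [him] at hc
  have hn : ‖(s * I : ℂ)‖ = s := by simp [hs.le]
  have h3 : ‖(1 + (s * I : ℂ) ^ 2)‖ = s ^ 2 - 1 := by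
    rw [mul_pow, I_sq, mul_neg_one, ← sub_eq_add_neg, ← ofReal_pow, ← ofReal_one, ← ofReal_sub,
      norm_real, Real.norm_eq_abs, abs_sub_comm, abs_of_nonneg (by nlinarith)]
  rw [nevFun_eq_cauchy 0 0 ν hz, ofReal_zero, zero_mul, zero_add, zero_add]
  refine (norm_add_le _ _).trans ?_
  rw [norm_mul _ (s * I : ℂ), norm_mul (1 + _), hn, h3, norm_real, Real.norm_of_nonneg hm]
  have h4 : s ^ 2 - 1 ≤ 3 := by nlinarith
  have h5 : (0 : ℝ) ≤ s ^ 2 - 1 := by nlinarith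
  have h6 : s⁻¹ ≤ 1 := inv_le_one_of_one_le₀ h1
  calc _ ≤ ν.real univ * 2 + 3 * (1 * ν.real univ) := by
        gcongr
        exact hc.trans (by gcongr)
    _ = _ := by ring

lemma poissonKer_mul_le {R x y : ℝ} (hx : |x| ≤ R) (hy : 0 < y) (hy1 : y ≤ 1) (t : ℝ) :
    poissonKer y x t ≤ (1 + 2 * R ^ 2) * (poissonKer 1 0 t * poissonKer y x t) +
      2 * poissonKer 1 0 t := by
  have h1 : poissonKer 1 0 t = 1 / (1 + t ^ 2) := by
    rw [poissonKer, sub_zero, one_pow, add_comm]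
  have hx2 : x ^ 2 ≤ R ^ 2 := sq_le_sq' (by linarith [neg_abs_le x]) (by linarith [le_abs_self x])
  have hP := poissonKer_nonneg hy x t
  have hPt : poissonKer y x t * (t - x) ^ 2 ≤ 1 := by
    rw [poissonKer, div_mul_eq_mul_div, div_le_one (by positivity)]
    nlinarith [sq_nonneg (t - x), sq_nonneg y]
  have ht : 1 + t ^ 2 ≤ 1 + 2 * R ^ 2 + 2 * (t - x) ^ 2 := by nlinarith [sq_nonneg (t - 2 * x)]
  have key : poissonKer y x t * (1 + t ^ 2) ≤ (1 + 2 * R ^ 2) * poissonKer y x t + 2 := by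
    nlinarith [mul_le_mul_of_nonneg_left ht hP]
  rw [h1]
  rw [show (1 + 2 * R ^ 2) * (1 / (1 + t ^ 2) * poissonKer y x t) + 2 * (1 / (1 + t ^ 2)) =
    ((1 + 2 * R ^ 2) * poissonKer y x t + 2) / (1 + t ^ 2) by ring, le_div_iff₀ (by positivity)]
  exact key

/-- The constant in the weak-type estimate on `[-R, R]`. -/
noncomputable def weakConst (R : ℝ) : ℝ := Real.pi / 4 / (1 + 2 * R ^ 2)

lemma weakConst_pos (R : ℝ) : 0 < weakConst R := by
  have := Real.pi_pos
  unfold weakConst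
  positivity

lemma weakConst_le (R : ℝ) : weakConst R ≤ Real.pi / 4 := by
  have := Real.pi_pos
  exact div_le_self (by positivity) (by nlinarith [sq_nonneg R])

/-- Weak-type estimate for a bounded analytic function with nonnegative real part. -/
lemma volume_re_ge_half_le {H : ℂ → ℂ} {ε R D : ℝ} (hε : 0 < ε)
    (hH : DifferentiableOn ℂ H {z | -ε < z.im}) (hB : ∀ z : ℂ, 0 ≤ z.im → ‖H z‖ ≤ 1)
    (hre : ∀ z : ℂ, 0 ≤ z.im → 0 ≤ (H z).re) (hD : Real.pi * (H I).re ≤ D)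
    (hDκ : D ≤ weakConst R / 2) :
    volume {x : ℝ | |x| ≤ R ∧ ∃ y : ℝ, 0 < y ∧ y ≤ 1 ∧ 1 / 2 ≤ (H (x + y * I)).re} ≤
      ENNReal.ofReal (100 / weakConst R) * ENNReal.ofReal D := by
  have hκ := weakConst_pos R
  have hcont : Continuous fun t : ℝ => (H t).re :=
    continuous_re.comp (continuous_restrict_real hε hH)
  have hg0 : ∀ t : ℝ, 0 ≤ (H t).re := fun t => hre _ (by simp)
  have hgint : ∀ {x y : ℝ}, 0 < y → Integrable fun t : ℝ => poissonKer y x t * (H t).re := by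
    intro x y hy
    have := (integrable_poissonKer_mul (x := x) hε hH hB hy).re
    simpa using this
  have hgeq : ∀ {x y : ℝ}, 0 < y →
      ∫ t : ℝ, poissonKer y x t * (H t).re = Real.pi * (H (x + y * I)).re := by
    intro x y hy
    have h1 := integral_poissonKer_mul (x := x) hε hH hB hy
    have h2 := integral_re (integrable_poissonKer_mul (x := x) hε hH hB hy)
    rw [h1] at h2
    simpa using h2
  have hP1 : ∀ t, 0 ≤ poissonKer 1 0 t := poissonKer_nonneg one_pos 0
  let w : ℝ → ℝ := fun t => poissonKer 1 0 t * (H t).re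
  have hw0 : ∀ t, 0 ≤ w t := fun t => mul_nonneg (hP1 t) (hg0 t)
  have hwc : Continuous w := (continuous_poissonKer one_pos 0).mul hcont
  have hwi : Integrable w := hgint one_pos
  have hwD : ∫ t, w t ≤ D := by
    refine le_trans (le_of_eq ?_) hD
    have := hgeq (x := 0) one_pos
    simpa using this
  let μ : Measure ℝ := volume.withDensity fun t => ENNReal.ofReal (w t)
  have hμ : μ univ ≤ ENNReal.ofReal D := by
    simp only [μ]
    rw [withDensity_apply _ MeasurableSet.univ, Measure.restrict_univ,
      ← ofReal_integral_eq_lintegral_ofReal hwi (ae_of_all _ hw0)]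
    exact ENNReal.ofReal_le_ofReal hwD
  refine (volume_le_of_poisson_large (μ := μ) hκ
    (hμ.trans (ENNReal.ofReal_le_ofReal hDκ)) ?_).trans (by gcongr)
  rintro x ⟨hx, y, hy, hy1, hxy⟩
  refine ⟨y, hy, hy1, ?_⟩
  have hPc := continuous_poissonKer hy x
  have hP := poissonKer_nonneg hy x
  have hwPi : Integrable fun t => w t * poissonKer y x t := by
    refine hwi.mul_bdd (c := y⁻¹) hPc.aestronglyMeasurable (ae_of_all _ fun t => ?_)
    rw [Real.norm_of_nonneg (hP t), poissonKer, div_le_iff₀ (by positivity), inv_mul_eq_div,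
      le_div_iff₀ hy]
    nlinarith [sq_nonneg (t - x)]
  have hPm : AEMeasurable (fun t => ENNReal.ofReal (poissonKer y x t)) volume := by fun_prop
  have hwm : AEMeasurable (fun t => ENNReal.ofReal (w t)) volume := by fun_prop
  have hμe := lintegral_withDensity_eq_lintegral_mul₀ hwm hPm
  rw [hμe]
  have : ∀ t, ((fun t => ENNReal.ofReal (w t)) * fun t => ENNReal.ofReal (poissonKer y x t)) t =
      ENNReal.ofReal (w t * poissonKer y x t) := fun t => (ENNReal.ofReal_mul (hw0 t)).symm
  simp only [this]
  rw [← ofReal_integral_eq_lintegral_ofReal hwPi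
    (ae_of_all _ fun t => mul_nonneg (hw0 t) (hP t))]
  refine ENNReal.ofReal_le_ofReal ?_
  have h1 : Real.pi * (H (x + y * I)).re ≤
      (1 + 2 * R ^ 2) * (∫ t, w t * poissonKer y x t) + 2 * ∫ t, w t := by
    rw [← hgeq hy, ← integral_const_mul, ← integral_const_mul,
      ← integral_add (hwPi.const_mul _) (hwi.const_mul _)]
    refine integral_mono (hgint hy) ((hwPi.const_mul _).add (hwi.const_mul _)) fun t => ?_
    have := mul_le_mul_of_nonneg_right (poissonKer_mul_le hx hy hy1 t) (hg0 t)
    refine this.trans (le_of_eq ?_)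
    simp only [w]
    ring
  have hpi := Real.pi_pos
  have h2 : Real.pi / 2 ≤ Real.pi * (H (x + y * I)).re := by nlinarith
  have h3 := weakConst_le R
  rw [weakConst, div_le_iff₀ (by positivity)]
  linarith

/-- The Cayley-type transform `w / (w + iλ)` used to bound the level sets. -/
noncomputable def cayleyLevel (l : ℝ) (w : ℂ) : ℂ := w / (w + l * I)

lemma normSq_add_real_mul_I (l : ℝ) (w : ℂ) : normSq (w + l * I) = w.re ^ 2 + (w.im + l) ^ 2 := by
  rw [normSq_apply]
  simp
  ring

lemma cayleyLevel_denom_ne {l : ℝ} (hl : 0 < l) {w : ℂ} (hw : 0 ≤ w.im) : w + l * I ≠ 0 := by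
  intro h
  have := congrArg Complex.im h
  simp at this
  linarith

lemma cayleyLevel_re (l : ℝ) (w : ℂ) : (cayleyLevel l w).re =
    (w.re ^ 2 + w.im ^ 2 + w.im * l) / (w.re ^ 2 + (w.im + l) ^ 2) := by
  rw [cayleyLevel, div_re, normSq_add_real_mul_I]
  simp
  ring

lemma cayleyLevel_re_nonneg {l : ℝ} (hl : 0 < l) {w : ℂ} (hw : 0 ≤ w.im) :
    0 ≤ (cayleyLevel l w).re := by
  rw [cayleyLevel_re]
  positivity

lemma half_le_cayleyLevel_re {l : ℝ} (hl : 0 < l) {w : ℂ} (hw : 0 ≤ w.im) (hlw : l ≤ ‖w‖) :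
    1 / 2 ≤ (cayleyLevel l w).re := by
  have h : l ^ 2 ≤ w.re ^ 2 + w.im ^ 2 := by
    have : ‖w‖ ^ 2 = w.re ^ 2 + w.im ^ 2 := by rw [← normSq_eq_norm_sq, normSq_apply]; ring
    rw [← this]
    gcongr
  rw [cayleyLevel_re, div_le_div_iff₀ (by positivity) (by positivity)]
  nlinarith

lemma norm_cayleyLevel_le {l : ℝ} (hl : 0 < l) {w : ℂ} (hw : 0 ≤ w.im) :
    ‖cayleyLevel l w‖ ≤ ‖w‖ / l := by
  rw [cayleyLevel, norm_div]
  gcongr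
  refine le_trans ?_ (abs_im_le_norm _)
  simp only [add_im, mul_im, ofReal_re, I_im, mul_one, ofReal_im, I_re, mul_zero, add_zero]
  exact (by linarith : l ≤ w.im + l).trans (le_abs_self _)

lemma norm_cayleyLevel_le_one {l : ℝ} (hl : 0 < l) {w : ℂ} (hw : 0 ≤ w.im) :
    ‖cayleyLevel l w‖ ≤ 1 := by
  rw [cayleyLevel, norm_div]
  refine div_le_one_of_le₀ ?_ (norm_nonneg _)
  refine le_of_sq_le_sq ?_ (norm_nonneg _)
  rw [← normSq_eq_norm_sq, ← normSq_eq_norm_sq, normSq_add_real_mul_I, normSq_apply]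
  nlinarith

/-- Weak-type estimate for the vertical maximal function of a Nevanlinna integral. -/
lemma volume_norm_nevFun_gt_le (ν : Measure ℝ) [IsFiniteMeasure ν] {l R : ℝ} (hl : 0 < l)
    (hν : 5 * Real.pi * ν.real univ / l ≤ weakConst R / 2) :
    volume {x : ℝ | |x| ≤ R ∧ ∃ y : ℝ, 0 < y ∧ y < 1 ∧ l < ‖nevFun 0 0 ν (x + y * I)‖} ≤
      ENNReal.ofReal (100 / weakConst R) * ENNReal.ofReal (5 * Real.pi * ν.real univ / l) := by
  set F := nevFun 0 0 ν with hF
  have hFim : ∀ z : ℂ, 0 < z.im → 0 ≤ (F z).im := fun z hz => by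
    have := im_nevFun_nonneg le_rfl 0 ν hz
    exact this
  let ε : ℕ → ℝ := fun n => 1 / ((n : ℝ) + 1)
  have hεpos : ∀ n, 0 < ε n := fun n => by positivity
  have hε1 : ∀ n, ε n ≤ 1 := fun n => by
    refine div_le_one_of_le₀ ?_ (by positivity)
    linarith [(n.cast_nonneg : (0 : ℝ) ≤ n)]
  have hεanti : Antitone ε := fun m n hmn => by
    simp only [ε]
    gcongr
  have hε0 : Tendsto ε atTop (𝓝 0) := tendsto_one_div_add_atTop_nhds_zero_nat
  let A : ℕ → Set ℝ := fun n => {x | |x| ≤ R ∧ ∃ y : ℝ, ε n < y ∧ y < 1 ∧ l < ‖F (x + y * I)‖}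
  have hmono : Monotone A := by
    rintro m n hmn x ⟨hx, y, hy, h⟩
    exact ⟨hx, y, (hεanti hmn).trans_lt hy, h⟩
  have hsub : {x : ℝ | |x| ≤ R ∧ ∃ y : ℝ, 0 < y ∧ y < 1 ∧ l < ‖F (x + y * I)‖} ⊆ ⋃ n, A n := by
    rintro x ⟨hx, y, hy, h⟩
    obtain ⟨n, hn⟩ := (hε0.eventually (gt_mem_nhds hy)).exists
    exact mem_iUnion.2 ⟨n, hx, y, hn, h⟩
  refine (measure_mono hsub).trans ?_
  rw [hmono.measure_iUnion]
  refine iSup_le fun n => ?_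
  let H : ℂ → ℂ := fun s => cayleyLevel l (F (s + ε n * I))
  have him : ∀ s : ℂ, (s + ε n * I).im = s.im + ε n := fun s => by simp
  have hpos : ∀ s : ℂ, 0 ≤ s.im → 0 < (s + ε n * I).im := fun s hs => by
    rw [him]
    linarith [hεpos n]
  have hHd : DifferentiableOn ℂ H {z | -(ε n) < z.im} := by
    have h1 : DifferentiableOn ℂ (fun s : ℂ => F (s + ε n * I)) {z | -(ε n) < z.im} := by
      refine (differentiableOn_nevFun 0 0 ν).comp (by fun_prop) fun s hs => ?_
      simp only [mem_ofPred_eq, him] at hs ⊢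
      linarith
    refine h1.div (h1.add (by fun_prop)) fun s hs => ?_
    refine cayleyLevel_denom_ne hl (hFim _ ?_)
    simp only [mem_ofPred_eq, him] at hs ⊢
    linarith
  refine (measure_mono ?_).trans (volume_re_ge_half_le (H := H) (hεpos n) hHd
    (fun z hz => norm_cayleyLevel_le_one hl (hFim _ (hpos z hz)))
    (fun z hz => cayleyLevel_re_nonneg hl (hFim _ (hpos z hz))) ?_ hν)
  · rintro x ⟨hx, y, hy, hy1, h⟩
    refine ⟨hx, y - ε n, by linarith, by linarith [hεpos n], ?_⟩
    have e : (x + (y - ε n : ℝ) * I + ε n * I : ℂ) = x + y * I := by push_cast; ring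
    simp only [H]
    rw [e]
    exact half_le_cayleyLevel_re hl (hFim _ (by simpa using (hεpos n).trans hy)) h.le
  · have e : (I + ε n * I : ℂ) = (1 + ε n : ℝ) * I := by push_cast; ring
    have hle : (H I).re ≤ 5 * ν.real univ / l := by
      refine (re_le_norm _).trans ((norm_cayleyLevel_le hl (hFim _ (hpos I (by simp)))).trans ?_)
      rw [e]
      gcongr
      exact norm_nevFun_imaginary_le ν (by linarith [hεpos n]) (by linarith [hε1 n])
    calc Real.pi * (H I).re ≤ Real.pi * (5 * ν.real univ / l) := by
          have := Real.pi_pos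
          gcongr
      _ = _ := by ring

lemma exists_isCompact_null_subset {ρ : Measure ℝ} [IsFiniteMeasure ρ] {J : Set ℝ} (hJ : IsOpen J)
    (hsing : ρ.restrict J ⟂ₘ (volume : Measure ℝ)) {η : ℝ} (hη : 0 < η) :
    ∃ K ⊆ J, IsCompact K ∧ volume K = 0 ∧ ρ (J \ K) ≤ ENNReal.ofReal η := by
  obtain ⟨s, hs, hρs, hvs⟩ := hsing
  have hT : MeasurableSet (sᶜ ∩ J) := hs.compl.inter hJ.measurableSet
  obtain ⟨K, hKT, hK, hKη⟩ := hT.exists_isCompact_sdiff_lt (measure_ne_top ρ _)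
    (ENNReal.ofReal_pos.2 hη).ne'
  refine ⟨K, hKT.trans inter_subset_right, hK,
    measure_mono_null (hKT.trans inter_subset_left) hvs, ?_⟩
  rw [Measure.restrict_apply hs] at hρs
  calc ρ (J \ K) ≤ ρ ((s ∩ J) ∪ ((sᶜ ∩ J) \ K)) := by
        refine measure_mono fun x hx => ?_
        by_cases h : x ∈ s
        · exact Or.inl ⟨h, hx.1⟩
        · exact Or.inr ⟨⟨h, hx.1⟩, hx.2⟩
    _ ≤ ρ (s ∩ J) + ρ ((sᶜ ∩ J) \ K) := measure_union_le _ _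
    _ ≤ _ := by
        rw [hρs, zero_add]
        exact hKη.le

/-- Almost everywhere on an open set where the measure is singular, the vertical oscillation of
`nevFun` is small. -/
lemma ae_eventually_norm_sub_le (α β : ℝ) {ρ : Measure ℝ} [IsFiniteMeasure ρ] {J : Set ℝ}
    (hJ : IsOpen J) {R : ℝ} (hR : ∀ x ∈ J, |x| ≤ R)
    (hsing : ρ.restrict J ⟂ₘ (volume : Measure ℝ)) {l : ℝ} (hl : 0 < l) :
    ∀ᵐ x : ℝ, x ∈ J → ∃ L : ℝ, ∀ᶠ ε : ℝ in 𝓝[>] 0, ‖nevFun α β ρ (x + ε * I) - L‖ ≤ 2 * l := by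
  have hκ := weakConst_pos R
  have hpi := Real.pi_pos
  suffices h : ∀ δ : ℝ, 0 < δ → δ ≤ weakConst R / 2 →
      volume {x : ℝ | ¬ (x ∈ J → ∃ L : ℝ, ∀ᶠ ε : ℝ in 𝓝[>] 0,
        ‖nevFun α β ρ (x + ε * I) - L‖ ≤ 2 * l)} ≤
      ENNReal.ofReal (100 / weakConst R) * ENNReal.ofReal δ by
    rw [ae_iff, ← nonpos_iff_eq_zero]
    have hlim : Tendsto (fun δ : ℝ => ENNReal.ofReal (100 / weakConst R) * ENNReal.ofReal δ)
        (𝓝[>] 0) (𝓝 (ENNReal.ofReal (100 / weakConst R) * ENNReal.ofReal 0)) := by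
      refine ENNReal.Tendsto.const_mul ?_ (Or.inr ENNReal.ofReal_ne_top)
      exact (ENNReal.continuous_ofReal.tendsto 0).mono_left nhdsWithin_le_nhds
    rw [ENNReal.ofReal_zero, mul_zero] at hlim
    refine ge_of_tendsto hlim ?_
    filter_upwards [Ioc_mem_nhdsGT (half_pos hκ)] with δ hδ using h δ hδ.1 hδ.2
  intro δ hδ hδκ
  obtain ⟨K, hKJ, hK, hK0, hKη⟩ := exists_isCompact_null_subset hJ hsing
    (η := δ * l / (5 * Real.pi)) (by positivity)
  have hW : IsOpen (J \ K) := hJ.sdiff hK.isClosed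
  set ν := ρ.restrict (J \ K) with hν
  set ν' := ρ.restrict (J \ K)ᶜ with hν'
  have hνδ : 5 * Real.pi * ν.real univ / l ≤ δ := by
    have h1 : ν.real univ ≤ δ * l / (5 * Real.pi) := by
      rw [measureReal_def, hν, Measure.restrict_apply_univ]
      exact ENNReal.toReal_le_of_le_ofReal (by positivity) hKη
    rw [div_le_iff₀ hl]
    rw [le_div_iff₀ (by positivity)] at h1
    linarith
  have hsum : ρ = ν' + ν := by
    rw [add_comm]
    exact (Measure.restrict_add_restrict_compl hW.measurableSet).symm
  refine (measure_mono (t := K ∪ {x : ℝ | |x| ≤ R ∧ ∃ y : ℝ, 0 < y ∧ y < 1 ∧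
    l < ‖nevFun 0 0 ν (x + y * I)‖}) ?_).trans ?_
  · intro x hx
    simp only [mem_ofPred_eq, Classical.not_imp] at hx
    obtain ⟨hxJ, hx⟩ := hx
    by_contra hnot
    simp only [mem_union, mem_ofPred_eq, not_or, not_and, not_exists, not_lt] at hnot
    obtain ⟨hxK, hsmall⟩ := hnot
    obtain ⟨d, hd, hball⟩ := Metric.isOpen_iff.1 hW x ⟨hxJ, hxK⟩
    obtain ⟨L, hL⟩ := exists_tendsto_nevFun α β ν' hd (by
      rw [hν', Measure.restrict_apply measurableSet_ball]
      convert measure_empty (μ := ρ)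
      exact disjoint_iff_inter_eq_empty.1 (disjoint_compl_right_iff_subset.2 hball))
    refine hx ⟨L, ?_⟩
    have hev := (tendsto_iff_norm_sub_tendsto_zero.1 hL).eventually (gt_mem_nhds hl)
    filter_upwards [hev, Ioo_mem_nhdsGT one_pos] with ε h1 h2
    have hz : 0 < (x + ε * I : ℂ).im := by simpa using h2.1
    rw [hsum, nevFun_add_measure α β ν' ν hz, add_sub_right_comm]
    refine (norm_add_le _ _).trans ?_
    linarith [hsmall (hR x hxJ) ε h2.1 h2.2]
  · refine (measure_union_le _ _).trans ?_
    rw [hK0, zero_add]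
    refine (volume_norm_nevFun_gt_le ν hl (hνδ.trans hδκ)).trans ?_
    gcongr

/-- A function whose vertical oscillation around real values is arbitrarily small has a real
vertical limit. -/
lemma exists_real_tendsto {φ : ℝ → ℂ}
    (h : ∀ k : ℕ, ∃ L : ℝ, ∀ᶠ ε : ℝ in 𝓝[>] 0, ‖φ ε - L‖ ≤ 2 * (1 / ((k : ℝ) + 1))) :
    ∃ L : ℝ, Tendsto φ (𝓝[>] 0) (𝓝 (L : ℂ)) := by
  have hlim : Tendsto (fun k : ℕ => 2 * (1 / ((k : ℝ) + 1))) atTop (𝓝 0) := by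
    simpa using tendsto_one_div_add_atTop_nhds_zero_nat.const_mul (2 : ℝ)
  have hcauchy : Cauchy (map φ (𝓝[>] 0)) := by
    rw [Metric.cauchy_iff]
    refine ⟨inferInstance, fun e he => ?_⟩
    obtain ⟨k, hk⟩ := (hlim.eventually (gt_mem_nhds (half_pos he))).exists
    obtain ⟨L, hL⟩ := h k
    refine ⟨{w | ‖w - L‖ ≤ 2 * (1 / ((k : ℝ) + 1))}, hL, fun a ha b hb => ?_⟩
    simp only [mem_ofPred_eq, ← dist_eq_norm] at ha hb
    linarith [dist_triangle_right a b (L : ℂ)]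
  obtain ⟨w, hw⟩ := cauchy_map_iff_exists_tendsto.1 hcauchy
  have him : |w.im| ≤ 0 := by
    refine ge_of_tendsto' hlim fun k => ?_
    obtain ⟨L, hL⟩ := h k
    have h1 : ‖w - L‖ ≤ 2 * (1 / ((k : ℝ) + 1)) := le_of_tendsto (hw.sub_const _).norm hL
    have h2 := abs_im_le_norm (w - L)
    simp only [sub_im, ofReal_im, sub_zero] at h2
    exact h2.trans h1
  refine ⟨w.re, ?_⟩
  have : (w.re : ℂ) = w := Complex.ext (by simp) (by simpa using (abs_nonpos_iff.1 him).symm)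
  rwa [this]

/-- On an open set where the measure is singular, the boundary values of `nevFun` exist and are real
almost everywhere. -/
lemma ae_exists_tendsto_nevFun (α β : ℝ) {ρ : Measure ℝ} [IsFiniteMeasure ρ] {J : Set ℝ}
    (hJ : IsOpen J) (hsing : ρ.restrict J ⟂ₘ (volume : Measure ℝ)) :
    ∀ᵐ x : ℝ, x ∈ J → ∃ L : ℝ,
      Tendsto (fun ε : ℝ => nevFun α β ρ (x + ε * I)) (𝓝[>] 0) (𝓝 (L : ℂ)) := by
  have h : ∀ n k : ℕ, ∀ᵐ x : ℝ, x ∈ J ∩ Metric.ball 0 n → ∃ L : ℝ, ∀ᶠ ε : ℝ in 𝓝[>] 0,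
      ‖nevFun α β ρ (x + ε * I) - L‖ ≤ 2 * (1 / ((k : ℝ) + 1)) := fun n k =>
    ae_eventually_norm_sub_le α β (hJ.inter Metric.isOpen_ball) (R := n)
      (fun x hx => by simpa using (mem_ball_zero_iff.1 hx.2).le)
      (hsing.mono_ac (Measure.absolutelyContinuous_of_le
        (Measure.restrict_mono inter_subset_left le_rfl)) Measure.AbsolutelyContinuous.rfl)
      (by positivity)
  filter_upwards [ae_all_iff.2 fun n => ae_all_iff.2 (h n)] with x hx hxJ
  obtain ⟨n, hn⟩ := exists_nat_gt |x|
  exact exists_real_tendsto fun k => hx n k ⟨hxJ, mem_ball_zero_iff.2 (by simpa using hn)⟩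

lemma complex_sqrt_sq (w : ℂ) : Complex.sqrt w ^ 2 = w := by
  simp [Complex.sqrt]

lemma norm_complex_sqrt_sq (w : ℂ) : ‖Complex.sqrt w‖ ^ 2 = ‖w‖ := by
  rw [← norm_pow, complex_sqrt_sq]

lemma one_le_norm_one_add_sqrt (w : ℂ) : 1 ≤ ‖1 + Complex.sqrt w‖ := by
  have h : 0 ≤ (Complex.sqrt w).re := by
    rw [Complex.sqrt, Complex.cpow_inv_two_re]
    positivity
  refine le_trans ?_ (re_le_norm _)
  rw [add_re, one_re]
  linarith

lemma one_add_sqrt_ne_zero (w : ℂ) : 1 + Complex.sqrt w ≠ 0 :=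
  norm_pos_iff.1 (one_pos.trans_le (one_le_norm_one_add_sqrt w))

lemma im_inv_one_add_sqrt_ofReal {s : ℝ} (hs : 0 ≤ s) :
    ((1 + Complex.sqrt (s : ℂ))⁻¹).im = 0 := by
  rw [Complex.sqrt_of_nonneg (by exact_mod_cast hs)]
  norm_cast

/-- A singular measure has a point of infinite density in any set it charges. -/
lemma exists_density_point {ρ : Measure ℝ} [IsFiniteMeasure ρ] {J : Set ℝ} (hJ : MeasurableSet J)
    (hne : ρ J ≠ 0) (hsing : ρ.restrict J ⟂ₘ (volume : Measure ℝ)) :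
    ∃ x ∈ J, Tendsto (fun r => ρ.real (Metric.closedBall x r) / (2 * r)) (𝓝[>] 0) atTop := by
  have hne' : ρ.restrict J ≠ 0 := by
    rwa [Ne, Measure.restrict_eq_zero]
  have : NeBot (ae (ρ.restrict J)) := ae_neBot.2 hne'
  have h1 := Besicovitch.ae_tendsto_rnDeriv (volume : Measure ℝ) (ρ.restrict J)
  have h2 := hsing.symm.rnDeriv_ae_eq_zero
  obtain ⟨x, ⟨hx1, hx2⟩, hxJ⟩ := ((h1.and h2).and (ae_restrict_mem hJ)).exists
  refine ⟨x, hxJ, ?_⟩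
  rw [hx2, Pi.zero_apply] at hx1
  refine tendsto_atTop.2 fun N => ?_
  have hN : 0 < max N 1 := by positivity
  have hev := hx1.eventually (gt_mem_nhds (ENNReal.ofReal_pos.2 (inv_pos.2 hN)))
  filter_upwards [hev, self_mem_nhdsWithin] with r hr hr0
  have hr0 : (0 : ℝ) < r := hr0
  rw [Real.volume_closedBall] at hr
  have hm : ENNReal.ofReal (2 * r) < ENNReal.ofReal (max N 1)⁻¹ * ρ (Metric.closedBall x r) := by
    rw [ENNReal.div_lt_iff (Or.inr (by simpa using hr0)) (Or.inl (measure_ne_top _ _))] at hr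
    refine hr.trans_le ?_
    gcongr
    exact Measure.restrict_le_self
  rw [← ofReal_measureReal, ← ENNReal.ofReal_mul (by positivity)] at hm
  have h4 := (ENNReal.ofReal_lt_ofReal_iff_of_nonneg (by positivity)).1 hm
  rw [inv_mul_eq_div, lt_div_iff₀ hN] at h4
  rw [le_div_iff₀ (by positivity)]
  nlinarith [le_max_left N 1]

/-- The boundary values cannot be one-sidedly bounded near a charged set of singularity. -/
lemma not_ae_one_le_boundary {α : ℝ} (hα : 0 ≤ α) (β : ℝ) {ρ : Measure ℝ} [IsFiniteMeasure ρ]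
    {J : Set ℝ} (hJ : IsOpen J) (hne : ρ J ≠ 0) (hsing : ρ.restrict J ⟂ₘ (volume : Measure ℝ))
    {σ c : ℝ} (hσ : |σ| = 1)
    (hbd : ∀ᵐ x : ℝ, x ∈ J → ∃ L : ℝ,
      Tendsto (fun ε : ℝ => nevFun α β ρ (x + ε * I)) (𝓝[>] 0) (𝓝 (L : ℂ)) ∧ 1 ≤ σ * L + c) :
    False := by
  have hσ0 : σ ≠ 0 := fun h => by simp [h] at hσ
  have hρ : ρ ≠ 0 := fun h => hne (by simp [h])
  let g : ℂ → ℂ := fun z => σ * nevFun α β ρ z + c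
  have hgim : ∀ z, (g z).im = σ * (nevFun α β ρ z).im := fun z => by simp [g]
  have hgslit : ∀ z : ℂ, 0 < z.im → g z ∈ slitPlane := fun z hz => by
    refine Or.inr ?_
    rw [hgim]
    exact mul_ne_zero hσ0 (im_nevFun_pos hα β hρ hz).ne'
  let E : ℂ → ℂ := fun z => (1 + Complex.sqrt (g z))⁻¹
  have hEd : DifferentiableOn ℂ E {z | 0 < z.im} := by
    refine DifferentiableOn.inv ?_ fun z _ => one_add_sqrt_ne_zero _
    refine (DifferentiableOn.comp Complex.differentiableOn_sqrt ?_ hgslit).const_add 1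
    exact ((differentiableOn_nevFun α β ρ).const_mul (σ : ℂ)).add_const (c : ℂ)
  have hEB : ∀ z : ℂ, 0 < z.im → ‖E z‖ ≤ 1 := fun z _ => by
    simp only [E]
    rw [norm_inv]
    exact inv_le_one_of_one_le₀ (one_le_norm_one_add_sqrt _)
  obtain ⟨x, hxJ, hx⟩ := exists_density_point hJ.measurableSet hne hsing
  obtain ⟨d, hd, hball⟩ := Metric.isOpen_iff.1 hJ x hxJ
  have hEim : ∀ᵐ t : ℝ, t ∈ Metric.ball x d →
      Tendsto (fun ε : ℝ => (E (t + ε * I)).im) (𝓝[>] 0) (𝓝 0) := by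
    filter_upwards [hbd] with t ht htd
    obtain ⟨L, hL, hL1⟩ := ht (hball htd)
    have hg : Tendsto (fun ε : ℝ => g (t + ε * I)) (𝓝[>] 0) (𝓝 ((σ * L + c : ℝ) : ℂ)) := by
      have := (hL.const_mul (σ : ℂ)).add_const (c : ℂ)
      simpa [g] using this
    have hcs : ContinuousAt (fun w : ℂ => (1 + Complex.sqrt w)⁻¹) ((σ * L + c : ℝ) : ℂ) := by
      refine ContinuousAt.inv₀ (continuousAt_const.add ?_) (one_add_sqrt_ne_zero _)
      exact Complex.continuousAt_sqrt (Or.inl (by rw [ofReal_re]; linarith))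
    have := (continuous_im.tendsto _).comp (hcs.tendsto.comp hg)
    rwa [im_inv_one_add_sqrt_ofReal (by linarith)] at this
  have hE0 : Tendsto (fun y : ℝ => E (x + y * I)) (𝓝[>] 0) (𝓝 0) := by
    have h1 : Tendsto (fun y : ℝ => ‖g (x + y * I)‖) (𝓝[>] 0) atTop := by
      refine tendsto_atTop_mono' _ ?_ hx
      filter_upwards [self_mem_nhdsWithin] with y hy
      refine (le_im_nevFun hα β ρ hy).trans (le_trans ?_ (abs_im_le_norm _))
      rw [hgim, abs_mul, hσ, one_mul]
      exact le_abs_self _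
    rw [tendsto_zero_iff_norm_tendsto_zero]
    simp only [E, norm_inv]
    refine tendsto_inv_atTop_zero.comp ?_
    have h2 : Tendsto (fun y : ℝ => ‖Complex.sqrt (g (x + y * I))‖) (𝓝[>] 0) atTop := by
      have := Real.tendsto_sqrt_atTop.comp h1
      refine this.congr fun y => ?_
      simp only [Function.comp]
      rw [← norm_complex_sqrt_sq, Real.sqrt_sq (norm_nonneg _)]
    refine tendsto_atTop_mono (fun y => ?_) (tendsto_atTop_add_const_right _ (-1) h2)
    have := norm_sub_le_norm_add (Complex.sqrt (g (x + y * I))) 1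
    rw [norm_one, add_comm (Complex.sqrt _)] at this
    linarith
  set C := (1 + (d ^ 2)⁻¹) * Real.pi with hC
  have hC0 : 0 < C := by have := Real.pi_pos; positivity
  have hEy : ∀ y : ℝ, 0 < y → ‖E (x + y * I)‖ ≤ C * y := by
    intro y hy
    have h1 : Tendsto (fun y' : ℝ => ‖E (x + y * I) - E (x + y' * I)‖) (𝓝[>] 0)
        (𝓝 ‖E (x + y * I) - 0‖) := (hE0.const_sub _).norm
    have h2 : Tendsto (fun y' : ℝ => |y - y'| * (1 + (d ^ 2)⁻¹) * Real.pi) (𝓝[>] 0)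
        (𝓝 (|y - 0| * (1 + (d ^ 2)⁻¹) * Real.pi)) :=
      (Continuous.tendsto (by fun_prop) 0).mono_left nhdsWithin_le_nhds
    rw [sub_zero] at h1
    rw [sub_zero, abs_of_pos hy, mul_assoc, mul_comm y] at h2
    refine le_of_tendsto_of_tendsto h1 h2 ?_
    filter_upwards [self_mem_nhdsWithin] with y' hy'
    exact norm_sub_le_of_im_tendsto_zero hd hEd hEB hEim hy hy'
  obtain ⟨C₁, hC₁⟩ := exists_norm_nevFun_le α β ρ x
  set K := |C₁| + |c| + 1 with hK
  have hK0 : 0 < K := by positivity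
  have hgK : ∀ y : ℝ, 0 < y → y ≤ 1 → ‖g (x + y * I)‖ ≤ K / y := by
    intro y hy hy1
    refine (norm_add_le _ _).trans ?_
    rw [norm_mul, norm_real, norm_real, Real.norm_eq_abs, hσ, one_mul, Real.norm_eq_abs]
    refine (add_le_add_left (hC₁ y hy hy1) _).trans ?_
    rw [le_div_iff₀ hy, add_mul, div_mul_cancel₀ _ hy.ne']
    nlinarith [le_abs_self C₁, abs_nonneg c]
  set y := min 1 (min (1 / (2 * C)) (1 / (8 * C ^ 2 * K))) with hy
  have hy0 : 0 < y := by positivity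
  have hy1 : y ≤ 1 := min_le_left _ _
  have hyC : C * y ≤ 1 / 2 := by
    have : y ≤ 1 / (2 * C) := (min_le_right _ _).trans (min_le_left _ _)
    rw [le_div_iff₀ (by positivity)] at this
    linarith
  have hyK : 8 * C ^ 2 * K * y ≤ 1 := by
    have : y ≤ 1 / (8 * C ^ 2 * K) := (min_le_right _ _).trans (min_le_right _ _)
    rw [le_div_iff₀ (by positivity)] at this
    linarith
  set s := ‖Complex.sqrt (g (x + y * I))‖ with hs
  have hs0 : 0 ≤ s := norm_nonneg _
  have hs2 : s ^ 2 * y ≤ K := by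
    rw [hs, norm_complex_sqrt_sq, ← le_div_iff₀ hy0]
    exact hgK y hy0 hy1
  have h1 : 1 ≤ C * y * (1 + s) := by
    have h2 : 1 = ‖E (x + y * I)‖ * ‖1 + Complex.sqrt (g (x + y * I))‖ := by
      rw [← norm_mul, inv_mul_cancel₀ (one_add_sqrt_ne_zero _), norm_one]
    have h3 : ‖1 + Complex.sqrt (g (x + y * I))‖ ≤ 1 + s := by
      simpa using norm_add_le (1 : ℂ) (Complex.sqrt (g (x + y * I)))
    refine h2.trans_le (mul_le_mul (hEy y hy0) h3 (norm_nonneg _) (by positivity))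
  have h2 : 1 / 2 ≤ C * y * s := by linarith
  have h3 : 1 / 4 ≤ C ^ 2 * y * (s ^ 2 * y) := by
    have : (1 / 2) ^ 2 ≤ (C * y * s) ^ 2 := by gcongr
    nlinarith
  have h4 : C ^ 2 * y * (s ^ 2 * y) ≤ C ^ 2 * y * K := by gcongr
  linarith

/-- If `f ∈ 𝓗` has Nevanlinna representation `(α, β, ρ)` and the restriction of `ρ` to an
open interval `J` is nonzero and singular with respect to Lebesgue measure, then the
boundary values of `f` are neither essentially bounded above nor below on `J`. -/
theorem not_essentially_bounded (f : ℂ → ℂ) (α β : ℝ) (ρ : Measure ℝ)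
    (hH : InH f) (hrep : NevRep f α β ρ)
    (J : Set ℝ) (u v : EReal)
    (hJ : J = {x : ℝ | u < (x : EReal) ∧ (x : EReal) < v})
    (hne : ρ J ≠ 0)
    (hsing : ρ.restrict J ⟂ₘ (volume : Measure ℝ)) :
    ∀ M : ℝ, 0 < M →
      0 < volume {x : ℝ | x ∈ J ∧ ∃ L : ℝ,
            Tendsto (fun ε : ℝ => f ((x : ℂ) + (ε : ℂ) * Complex.I)) (𝓝[>] 0) (𝓝 (L : ℂ)) ∧
            M < L} ∧
      0 < volume {x : ℝ | x ∈ J ∧ ∃ L : ℝ,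
            Tendsto (fun ε : ℝ => f ((x : ℂ) + (ε : ℂ) * Complex.I)) (𝓝[>] 0) (𝓝 (L : ℂ)) ∧
            L < -M} := by
  intro M _
  obtain ⟨hα, hfin, hf⟩ := hrep
  have hJo : IsOpen J := by
    have : J = ((↑) : ℝ → EReal) ⁻¹' Ioo u v := hJ
    rw [this]
    exact isOpen_Ioo.preimage continuous_coe_real_ereal
  have hae := ae_exists_tendsto_nevFun α β hJo hsing
  have hfeq : ∀ x : ℝ, (fun ε : ℝ => nevFun α β ρ (x + ε * I)) =ᶠ[𝓝[>] 0]
      fun ε : ℝ => f (x + ε * I) := fun x => by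
    filter_upwards [self_mem_nhdsWithin] with ε hε
    exact (hf _ (by simpa using hε)).symm
  constructor
  · refine pos_iff_ne_zero.2 fun h0 => ?_
    have hnot := measure_eq_zero_iff_ae_notMem.1 h0
    refine not_ae_one_le_boundary hα β hJo hne hsing (σ := -1) (c := M + 1) (by simp) ?_
    filter_upwards [hae, hnot] with x h1 h2 hxJ
    obtain ⟨L, hL⟩ := h1 hxJ
    refine ⟨L, hL, ?_⟩
    by_contra hlt
    exact h2 ⟨hxJ, L, hL.congr' (hfeq x), by linarith⟩
  · refine pos_iff_ne_zero.2 fun h0 => ?_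
    have hnot := measure_eq_zero_iff_ae_notMem.1 h0
    refine not_ae_one_le_boundary hα β hJo hne hsing (σ := 1) (c := M + 1) (by simp) ?_
    filter_upwards [hae, hnot] with x h1 h2 hxJ
    obtain ⟨L, hL⟩ := h1 hxJ
    refine ⟨L, hL, ?_⟩
    by_contra hlt
    exact h2 ⟨hxJ, L, hL.congr' (hfeq x), by linarith⟩
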